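/- arXiv:1801.02002 — 3 statements merged into one kernel-verified Lean document; each statement's English description precedes it below -/
import Mathlib

section
/- Let X be an infinite-dimensional reflexive Banach space. Then K_a(X) > 1: there exist an infinite set S in the unit ball of X and d > 1 such that for all distinct x, y ∈ S there is f ∈ B_{X*} with d ≤ f(x) - f(y) and f(y) ≤ f(z) ≤ f(x) for all z ∈ S. -/
open Set Filter

noncomputable section

/-- `S` is a `(c₁, c₂, d)`-bounded and separated antipodal subset of `X`. -/
def IsBSA (X : Type*) [NormedAddCommGroup X] [NormedSpace ℝ X] (S : Set X)
    (c₁ c₂ d : ℝ) : Prop :=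
  (∀ x ∈ S, ‖x‖ ≤ c₁) ∧
  ∀ x ∈ S, ∀ y ∈ S, x ≠ y → ∃ f : X →L[ℝ] ℝ, ‖f‖ ≤ c₂ ∧ d ≤ f y - f x ∧
    ∀ z ∈ S, f x ≤ f z ∧ f z ≤ f y

/-- The antipodal Kottman constant `K_a(X)`. -/
def Ka (X : Type*) [NormedAddCommGroup X] [NormedSpace ℝ X] : ℝ :=
  sSup {d : ℝ | ∃ S : Set X, S.Infinite ∧ IsBSA X S 1 1 d}

/-- The Kottman (separation) constant `K(X)`. -/
def Kc (X : Type*) [NormedAddCommGroup X] : ℝ :=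
  sSup {d : ℝ | ∃ S : Set X, S ⊆ Metric.closedBall 0 1 ∧ S.Infinite ∧
    ∀ x ∈ S, ∀ y ∈ S, x ≠ y → d ≤ ‖x - y‖}

section Helpers

variable {X : Type*} [NormedAddCommGroup X] [NormedSpace ℝ X]

/-- The alternating sum of a list whose last entry is read first. -/
def altSum : List X → X
  | [] => 0
  | x :: p => altSum p + (-1 : ℝ) ^ p.length • x

theorem altSum_append (p q : List X) :
    altSum (p ++ q) = altSum q + (-1 : ℝ) ^ q.length • altSum p := by
  induction p with
  | nil => simp [altSum]
  | cons x p ih =>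
    simp only [List.cons_append, altSum, ih, List.length_append, smul_add, smul_smul, pow_add]
    rw [add_assoc, mul_comm]

theorem altSum_append_singleton (p : List X) (x : X) :
    altSum (p ++ [x]) = x - altSum p := by
  simp [altSum_append, altSum, sub_eq_add_neg]

/-- The tree of alternating sums of norm at most `t` above `p`, with branching along `U`,
is well founded. -/
inductive Terminates (U : Filter X) (t : ℝ) : List X → Prop
  | mk (p : List X) (S : Set X) (hS : S ∈ U)
      (h : ∀ x ∈ S, ‖altSum (x :: p)‖ ≤ t → Terminates U t (x :: p)) : Terminates U t p

/-- `P` holds at almost every maximal node above `p` of the tree of alternating sums of norm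
at most `t`, with branching along `U`. -/
inductive Generic (U : Filter X) (t : ℝ) (P : List X → Prop) : List X → Prop
  | leaf (p : List X) (h : ∀ᶠ x in U, t < ‖altSum (x :: p)‖) (hP : P p) : Generic U t P p
  | node (p : List X) (S : Set X) (hS : S ∈ U)
      (hn : ∀ x ∈ S, ‖altSum (x :: p)‖ ≤ t)
      (h : ∀ x ∈ S, Generic U t P (x :: p)) : Generic U t P p

namespace Generic

variable {U : Ultrafilter X} {t : ℝ} {P Q : List X → Prop}

theorem mono (hPQ : ∀ p, P p → Q p) {p : List X} (h : Generic (U : Filter X) t P p) :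
    Generic (U : Filter X) t Q p := by
  induction h with
  | leaf p h hP => exact .leaf p h (hPQ p hP)
  | node p S hS hn _ ih => exact .node p S hS hn ih

theorem exists_of {p : List X} (h : Generic (U : Filter X) t P p) : ∃ q, P q := by
  induction h with
  | leaf p _ hP => exact ⟨p, hP⟩
  | node p S hS _ _ ih =>
    obtain ⟨x, hx⟩ := U.nonempty_of_mem hS
    exact ih x hx

theorem and {p : List X} (h : Generic (U : Filter X) t P p)
    (h' : Generic (U : Filter X) t Q p) : Generic (U : Filter X) t (fun q => P q ∧ Q q) p := by
  induction h with
  | leaf p h hP =>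
    cases h' with
    | leaf _ _ hQ => exact .leaf p h ⟨hP, hQ⟩
    | node _ S hS hn _ =>
      obtain ⟨x, hx, hxS⟩ := (h.and hS).exists
      exact absurd (hn x hxS) (not_le.2 hx)
  | node p S hS hn _ ih =>
    cases h' with
    | leaf _ h _ =>
      obtain ⟨x, hx, hxS⟩ := (h.and hS).exists
      exact absurd (hn x hxS) (not_le.2 hx)
    | node _ S' hS' _ hQ =>
      exact .node p (S ∩ S') (inter_mem hS hS') (fun x hx => hn x hx.1)
        fun x hx => ih x hx.1 (hQ x hx.2)

theorem and_invariant {I : List X → Prop}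
    (hI : ∀ p, I p → ∀ᶠ x in (U : Filter X), ‖altSum (x :: p)‖ ≤ t → I (x :: p))
    {p : List X} (h : Generic (U : Filter X) t P p) (hp : I p) :
    Generic (U : Filter X) t (fun q => P q ∧ I q) p := by
  induction h with
  | leaf p h hP => exact .leaf p h ⟨hP, hp⟩
  | node p S hS hn _ ih =>
    exact .node p (S ∩ _) (inter_mem hS (hI p hp)) (fun x hx => hn x hx.1)
      fun x hx => ih x hx.1 (hx.2 (hn x hx.1))

theorem and_apply_eq (f : X →L[ℝ] ℝ) (hf : ∀ᶠ x in (U : Filter X), f x = 0) (p₀ : List X)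
    {p : List X} (h : Generic (U : Filter X) t P p) :
    Generic (U : Filter X) t
      (fun q => P q ∧ f (altSum (q ++ p₀)) = f (altSum (p ++ p₀))) p := by
  refine h.and_invariant (I := fun q => f (altSum (q ++ p₀)) = f (altSum (p ++ p₀))) ?_ rfl
  intro q hq
  filter_upwards [hf] with x hx _
  rw [← hq]
  simp [altSum, hx]

theorem norm_le (hU : ∀ f : X →L[ℝ] ℝ, ∀ᶠ x in (U : Filter X), f x = 0) {r : ℝ}
    (p₀ : List X) {p : List X}
    (h : Generic (U : Filter X) t (fun q => ‖altSum (q ++ p₀)‖ ≤ r) p) :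
    ‖altSum (p ++ p₀)‖ ≤ r := by
  obtain ⟨f, hf, hfp⟩ := exists_dual_vector'' ℝ (altSum (p ++ p₀))
  obtain ⟨q, hq, hqf⟩ := (h.and_apply_eq f (hU f) p₀).exists_of
  have h1 := f.le_of_opNorm_le hf (altSum (q ++ p₀))
  have h2 := le_abs_self (f (altSum (q ++ p₀)))
  rw [Real.norm_eq_abs] at h1
  simp only [RCLike.ofReal_real_eq_id, id] at hfp
  linarith

theorem altSum_norm_le {p : List X} (h : Generic (U : Filter X) t P p)
    (hp : ‖altSum p‖ ≤ t) :
    Generic (U : Filter X) t (fun q => P q ∧ ‖altSum q‖ ≤ t) p :=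
  h.and_invariant (I := fun q => ‖altSum q‖ ≤ t)
    (fun _ _ => Eventually.of_forall fun _ hx => hx) hp

/-- Genericity for one threshold propagates along generic branches for another threshold `t`
which, once appended to `p₀`, stay below the first one. -/
theorem transfer (hU : ∀ f : X →L[ℝ] ℝ, ∀ᶠ x in (U : Filter X), f x = 0) {t' : ℝ}
    (p₀ : List X) {s : List X}
    (h : Generic (U : Filter X) t (fun q => ‖altSum (q ++ p₀)‖ ≤ t') s)
    (h' : Generic (U : Filter X) t' Q (s ++ p₀)) :
    Generic (U : Filter X) t (fun q => Generic (U : Filter X) t' Q (q ++ p₀)) s := by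
  induction h with
  | leaf s h _ => exact .leaf s h h'
  | node s S hS hn hg ih =>
    cases h' with
    | leaf _ h _ =>
      obtain ⟨x, hx, hxS⟩ := (h.and hS).exists
      exact absurd ((hg x hxS).norm_le hU p₀) (not_le.2 hx)
    | node _ S' hS' _ hQ =>
      exact .node s (S ∩ S') (inter_mem hS hS') (fun x hx => hn x hx.1)
        fun x hx => ih x hx.1 (hQ x hx.2)

theorem of_cons (hU1 : ∀ᶠ x in (U : Filter X), ‖x‖ = 1) (ht : 1 ≤ t)
    (h : Generic (U : Filter X) t P []) :
    ∀ᶠ x in (U : Filter X), Generic (U : Filter X) t P [x] := by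
  cases h with
  | leaf _ h _ =>
    obtain ⟨x, hx, hx1⟩ := (h.and hU1).exists
    simp [altSum] at hx
    linarith
  | node _ S hS _ h => exact mem_of_superset hS h

end Generic

theorem Terminates.generic_or {U : Ultrafilter X} {t : ℝ} (P : List X → Prop) {p : List X}
    (h : Terminates (U : Filter X) t p) :
    Generic (U : Filter X) t P p ∨ Generic (U : Filter X) t (fun q => ¬ P q) p := by
  induction h with
  | mk p S hS _ ih =>
    by_cases hb : ∀ᶠ x in (U : Filter X), t < ‖altSum (x :: p)‖
    · by_cases hP : P p
      · exact .inl (.leaf p hb hP)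
      · exact .inr (.leaf p hb hP)
    · have hb' : ∀ᶠ x in (U : Filter X), ‖altSum (x :: p)‖ ≤ t := by
        simpa using Ultrafilter.eventually_not.2 hb
      have hor : ∀ᶠ x in (U : Filter X), Generic (U : Filter X) t P (x :: p) ∨
          Generic (U : Filter X) t (fun q => ¬ P q) (x :: p) := by
        filter_upwards [hS, hb'] with x hx hxt using ih x hx hxt
      rcases Ultrafilter.eventually_or.1 hor with h | h
      · exact .inl (.node p _ (hb'.and h) (fun x hx => hx.1) fun x hx => hx.2)
      · exact .inr (.node p _ (hb'.and h) (fun x hx => hx.1) fun x hx => hx.2)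

theorem Terminates.exists_ultrafilter {U : Ultrafilter X} {t : ℝ}
    (h : Terminates (U : Filter X) t []) :
    ∃ W : Ultrafilter (List X), ∀ P : List X → Prop,
      (∀ᶠ l in (W : Filter (List X)), P l) ↔ Generic (U : Filter X) t P [] := by
  have hfalse : ¬ Generic (U : Filter X) t (fun _ => False) [] := fun h => by
    obtain ⟨_, hq⟩ := h.exists_of
    exact hq
  let L : Filter (List X) :=
    { sets := {A | Generic (U : Filter X) t (· ∈ A) []}
      univ_sets := by
        rcases h.generic_or (fun _ => True) with h | h
        · exact h.mono fun _ _ => mem_univ _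
        · exact absurd (h.mono fun _ hp => hp trivial) hfalse
      sets_of_superset := fun hA hAB => Generic.mono (fun _ hp => hAB hp) hA
      inter_sets := fun hA hB => Generic.and hA hB }
  have hL : ∀ A : Set (List X), A ∈ L ↔ Generic (U : Filter X) t (· ∈ A) [] := fun _ => Iff.rfl
  refine ⟨Ultrafilter.ofComplNotMemIff L fun A => ?_, fun P => Iff.rfl⟩
  rw [hL, hL]
  constructor
  · intro hA
    exact (h.generic_or (· ∈ A)).resolve_right hA
  · intro hA hA'
    exact hfalse ((hA.and hA').mono fun _ hp => hp.2 hp.1)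

/-- Pointwise limits of bounded functionals along an ultrafilter. -/
theorem exists_weakStar_limit {α : Type*} (W : Ultrafilter α) (G : α → X →L[ℝ] ℝ) (C : ℝ)
    (hG : ∀ a, ‖G a‖ ≤ C) :
    ∃ h : X →L[ℝ] ℝ, ∀ v, Tendsto (fun a => G a v) W (nhds (h v)) := by
  have hc := WeakDual.isCompact_closedBall (𝕜 := ℝ) (0 : StrongDual ℝ X) C
  obtain ⟨h, _, hh⟩ := hc.ultrafilter_le_nhds (W.map fun a => StrongDual.toWeakDual (G a)) (by
    rw [le_principal_iff]
    refine Filter.mem_map.2 (Eventually.of_forall fun a => ?_)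
    simpa using hG a)
  refine ⟨WeakDual.toStrongDual h, fun v => ?_⟩
  have := (WeakDual.eval_continuous v).tendsto h
  exact this.comp hh

theorem exists_norming :
    ∃ F : X → X →L[ℝ] ℝ, ∀ v, ‖F v‖ ≤ 1 ∧ F v v = ‖v‖ := by
  choose F hF using fun v : X => exists_dual_vector'' ℝ v
  exact ⟨F, fun v => by simpa using hF v⟩

theorem exists_ultrafilter_weakly_null (hinf : ¬FiniteDimensional ℝ X) :
    ∃ U : Ultrafilter X, (∀ᶠ x in (U : Filter X), ‖x‖ = 1) ∧
      ∀ f : X →L[ℝ] ℝ, ∀ᶠ x in (U : Filter X), f x = 0 := by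
  classical
  let A : Finset (X →L[ℝ] ℝ) → Set X := fun F => {x | ‖x‖ = 1 ∧ ∀ f ∈ F, f x = 0}
  have hA : ∀ F, (A F).Nonempty := by
    intro F
    let T : X →ₗ[ℝ] (F → ℝ) := LinearMap.pi fun f => (f.1 : X →ₗ[ℝ] ℝ)
    have hT : ¬ Function.Injective T := fun h => hinf (FiniteDimensional.of_injective T h)
    rw [← LinearMap.ker_eq_bot, Submodule.eq_bot_iff] at hT
    push Not at hT
    obtain ⟨x, hx, hx0⟩ := hT
    refine ⟨‖x‖⁻¹ • x, by simp [norm_smul, hx0], fun f hf => ?_⟩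
    have := congrFun (LinearMap.mem_ker.1 hx) ⟨f, hf⟩
    simp only [T, LinearMap.pi_apply, ContinuousLinearMap.coe_coe, Pi.zero_apply] at this
    simp [this]
  have hne : (⨅ F, 𝓟 (A F)).NeBot := by
    refine iInf_neBot_of_directed' ?_ fun F => principal_neBot_iff.2 (hA F)
    intro F G
    refine ⟨F ∪ G, principal_mono.2 fun x hx => ⟨hx.1, fun f hf => hx.2 f ?_⟩,
      principal_mono.2 fun x hx => ⟨hx.1, fun f hf => hx.2 f ?_⟩⟩
    · exact Finset.mem_union_left _ hf
    · exact Finset.mem_union_right _ hf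
  have hmem : ∀ F, ∀ᶠ x in (Ultrafilter.of (⨅ F, 𝓟 (A F)) : Filter X), x ∈ A F := fun F =>
    Ultrafilter.of_le _ (mem_iInf_of_mem F (mem_principal_self _))
  exact ⟨Ultrafilter.of (⨅ F, 𝓟 (A F)), (hmem ∅).mono fun x hx => hx.1,
    fun f => (hmem {f}).mono fun x hx => hx.2 f (Finset.mem_singleton_self f)⟩

/-- In a reflexive space there is no infinite bounded branch of alternating sums. -/
theorem terminates_nil (hrefl : Function.Surjective (NormedSpace.inclusionInDoubleDual ℝ X))
    {U : Ultrafilter X} (hU1 : ∀ᶠ x in (U : Filter X), ‖x‖ = 1)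
    (hU : ∀ f : X →L[ℝ] ℝ, ∀ᶠ x in (U : Filter X), f x = 0) {t : ℝ} (ht : 0 ≤ t) :
    Terminates (U : Filter X) t [] := by
  by_contra hnt
  obtain ⟨F, hF⟩ := exists_norming (X := X)
  obtain ⟨g, hg⟩ := exists_weakStar_limit U F 1 fun v => (hF v).1
  let Good : List X → Prop := fun p =>
    ¬ Terminates (U : Filter X) t p ∧ ‖altSum p‖ ≤ t ∧ ∀ q, q <:+ p → g (altSum q) = 0
  have hstep : ∀ p : {p // Good p}, ∃ x, Good (x :: p.1) ∧ ‖x‖ = 1 ∧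
      (∀ y ∈ p.1, F y x = 0) ∧ ∀ q, q <:+ p.1 → |F x (altSum q)| ≤ 1 / 4 := by
    rintro ⟨p, hp, -, hpg⟩
    have h1 : ∀ᶠ x in (U : Filter X), ∀ y ∈ {y | y ∈ p}, F y x = 0 :=
      (eventually_all_finite p.finite_toSet).2 fun y _ => hU (F y)
    have h2 : ∀ᶠ x in (U : Filter X), ∀ q ∈ {q | q ∈ p.tails}, |F x (altSum q)| ≤ 1 / 4 := by
      refine (eventually_all_finite p.tails.finite_toSet).2 fun q hq => ?_
      have := (hg (altSum q)).abs
      rw [hpg q ((List.mem_tails q p).1 hq), abs_zero] at this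
      exact this.eventually_le_const (by norm_num)
    have h3 : ∃ᶠ x in (U : Filter X),
        ‖altSum (x :: p)‖ ≤ t ∧ ¬ Terminates (U : Filter X) t (x :: p) := by
      intro h
      refine hp (.mk p _ h fun x hx hxt => ?_)
      by_contra hx'
      exact hx ⟨hxt, hx'⟩
    obtain ⟨x, ⟨hxt, hxT⟩, hx1, hxg, hxF, hxq⟩ :=
      (h3.and_eventually (hU1.and ((hU g).and (h1.and h2)))).exists
    refine ⟨x, ⟨hxT, hxt, fun q hq => ?_⟩, hx1, hxF,
      fun q hq => hxq q ((List.mem_tails q p).2 hq)⟩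
    rcases List.suffix_cons_iff.1 hq with rfl | hq
    · simp [altSum, hxg, hpg p List.suffix_rfl]
    · exact hpg q hq
  choose x hx using hstep
  have hgood0 : Good [] := ⟨hnt, by simpa [altSum] using ht, fun q hq => by
    rw [List.suffix_nil.1 hq]; simp [altSum]⟩
  let p : ℕ → {p // Good p} := fun n =>
    Nat.rec ⟨[], hgood0⟩ (fun _ p => ⟨x p :: p.1, (hx p).1⟩) n
  have hp : ∀ n, (p (n + 1)).1 = x (p n) :: (p n).1 := fun n => rfl
  have hsuff : ∀ m n, m ≤ n → (p m).1 <:+ (p n).1 := by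
    intro m n hmn
    induction n, hmn using Nat.le_induction with
    | base => exact List.suffix_rfl
    | succ n _ ih => rw [hp]; exact ih.trans (List.suffix_cons _ _)
  have hsmall : ∀ j k, j ≤ k → |F (x (p k)) (altSum (p j).1)| ≤ 1 / 4 := fun j k hjk =>
    (hx (p k)).2.2.2 _ (hsuff j k hjk)
  have hlarge : ∀ k j, k + 1 ≤ j → 3 / 4 ≤ |F (x (p k)) (altSum (p j).1)| := by
    intro k j hkj
    have heq : F (x (p k)) (altSum (p j).1) = F (x (p k)) (altSum (p (k + 1)).1) := by
      induction j, hkj using Nat.le_induction with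
      | base => rfl
      | succ n hn ih =>
        have hmem : x (p k) ∈ (p n).1 :=
          (hsuff _ _ hn).subset (by rw [hp]; exact List.mem_cons_self)
        rw [← ih, hp]
        simp [altSum, (hx (p n)).2.2.1 _ hmem]
    rw [heq, hp]
    have h1 := hsmall k k le_rfl
    have h2 : F (x (p k)) (x (p k)) = 1 := by rw [(hF _).2, (hx (p k)).2.1]
    simp only [altSum, map_add, map_smul, smul_eq_mul, h2, mul_one]
    have h3 : |(-1 : ℝ) ^ (p k).1.length| = 1 := by simp
    have h4 := abs_sub_abs_le_abs_sub ((-1 : ℝ) ^ (p k).1.length)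
      (-(F (x (p k)) (altSum (p k).1)))
    rw [h3, abs_neg, sub_neg_eq_add, add_comm ((-1 : ℝ) ^ _)] at h4
    linarith
  let ω : Ultrafilter ℕ := hyperfilter ℕ
  have hω : ∀ m : ℕ, ∀ᶠ n in (ω : Filter ℕ), m ≤ n := fun m =>
    (Nat.hyperfilter_le_atTop) (eventually_ge_atTop m)
  obtain ⟨f, hf⟩ := exists_weakStar_limit ω (fun k => F (x (p k))) 1 fun k => (hF _).1
  obtain ⟨Λ, hΛ⟩ := exists_weakStar_limit ω
    (fun k => NormedSpace.inclusionInDoubleDual ℝ X (altSum (p k).1)) t fun k =>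
      (NormedSpace.double_dual_bound ℝ X _).trans (p k).2.2.1
  obtain ⟨s, hs⟩ := hrefl Λ
  have hs' : ∀ φ : X →L[ℝ] ℝ,
      Tendsto (fun k => φ (altSum (p k).1)) (ω : Filter ℕ) (nhds (φ s)) := by
    intro φ
    have := hΛ φ
    rw [← hs] at this
    simpa using this
  have hle : |f s| ≤ 1 / 4 := by
    refine le_of_tendsto (hs' f).abs (Eventually.of_forall fun j => ?_)
    refine le_of_tendsto (hf (altSum (p j).1)).abs ?_
    filter_upwards [hω j] with k hk using hsmall j k hk
  have hge : 3 / 4 ≤ |f s| := by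
    refine ge_of_tendsto (hf s).abs (Eventually.of_forall fun k => ?_)
    refine ge_of_tendsto (hs' (F (x (p k)))).abs ?_
    filter_upwards [hω (k + 1)] with j hj using hlarge k j hj
  linarith

/-- Some single generic vector separates from the generic maximal alternating sums. -/
theorem exists_generic_gap {U : Ultrafilter X} (hU1 : ∀ᶠ x in (U : Filter X), ‖x‖ = 1)
    (hU : ∀ f : X →L[ℝ] ℝ, ∀ᶠ x in (U : Filter X), f x = 0)
    (hT : ∀ t, 1 ≤ t → Terminates (U : Filter X) t []) :
    ∃ t t' : ℝ, 1 ≤ t ∧ t < t' ∧ ∀ᶠ x in (U : Filter X),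
      Generic (U : Filter X) t (fun l => t' < ‖x - altSum l‖) [] := by
  by_contra! hcon
  have hno : ∀ t t' : ℝ, 1 ≤ t → t < t' → ∀ᶠ x in (U : Filter X),
      Generic (U : Filter X) t (fun l => ‖altSum (l ++ [x])‖ ≤ t') [] := by
    intro t t' ht htt'
    filter_upwards [hcon t t' ht htt'] with x hx
    refine (((hT t ht).generic_or _).resolve_left hx).mono fun l hl => ?_
    rw [altSum_append_singleton]
    exact not_lt.1 hl
  let τ : ℕ → ℝ := fun k => 1 + 1 / ((k : ℝ) + 1)
  have hτ1 : ∀ k, 1 ≤ τ k := fun k => by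
    have : (0 : ℝ) ≤ 1 / ((k : ℝ) + 1) := by positivity
    simp only [τ]; linarith
  have hτ : ∀ k, τ (k + 1) < τ k := fun k => by
    have : (1 : ℝ) / (((k + 1 : ℕ) : ℝ) + 1) < 1 / ((k : ℝ) + 1) := by
      apply one_div_lt_one_div_of_lt (by positivity)
      push_cast; linarith
    simp only [τ]; linarith
  let Bdd : ℕ → List X → Prop := fun k p =>
    Generic (U : Filter X) (τ k) (fun l => ‖altSum (l ++ p)‖ ≤ τ 0) []
  have hstep : ∀ k p, Bdd k p → ∀ᶠ x in (U : Filter X), Bdd (k + 1) (x :: p) := by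
    intro k p hk
    filter_upwards [hno (τ (k + 1)) (τ k) (hτ1 _) (hτ k), hk.of_cons hU1 (hτ1 k)] with x hx hx'
    refine (hx.transfer hU [x] hx').mono fun q hq => ?_
    have := hq.norm_le hU p
    simpa using this
  have hnot : ∀ p, Terminates (U : Filter X) (τ 0) p → ∀ k, ¬ Bdd k p := by
    intro p hp
    induction hp with
    | mk p S hS _ ih =>
      intro k hk
      obtain ⟨x, hx, hxS⟩ := ((hstep k p hk).and hS).exists
      exact ih x hxS (by simpa using hx.norm_le hU (x :: p)) _ hx
  refine hnot [] (hT _ (hτ1 0)) 0 ?_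
  have h0 := ((hT _ (hτ1 0)).generic_or fun _ => True).resolve_right fun h => by
    obtain ⟨_, hq⟩ := h.exists_of
    exact hq trivial
  refine (h0.altSum_norm_le ?_).mono fun q hq => ?_
  · have := hτ1 0
    simp only [altSum, norm_zero]; linarith
  · simpa using hq.2

/-- A weakly null ultrafilter on a ball whose generic pairs are separated by more than the
radius. -/
theorem exists_separated_ultrafilter (hinf : ¬FiniteDimensional ℝ X)
    (hrefl : Function.Surjective (NormedSpace.inclusionInDoubleDual ℝ X)) :
    ∃ (Z : Ultrafilter X) (t d : ℝ), 1 ≤ t ∧ t < d ∧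
      (∀ f : X →L[ℝ] ℝ, ∀ᶠ z in (Z : Filter X), f z = 0) ∧
      (∀ᶠ z in (Z : Filter X), ‖z‖ ≤ t) ∧
      ∀ᶠ y in (Z : Filter X), ∀ᶠ z in (Z : Filter X), d ≤ ‖y - z‖ := by
  obtain ⟨U, hU1, hU⟩ := exists_ultrafilter_weakly_null hinf
  have hT : ∀ t, 1 ≤ t → Terminates (U : Filter X) t [] := fun t ht =>
    terminates_nil hrefl hU1 hU (by linarith)
  obtain ⟨t, t', ht, htt', hgap⟩ := exists_generic_gap hU1 hU hT
  obtain ⟨W, hW⟩ := (hT t ht).exists_ultrafilter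
  obtain ⟨F, hF⟩ := exists_norming (X := X)
  have htrue : Generic (U : Filter X) t (fun _ => True) [] :=
    (hW _).1 (Eventually.of_forall fun _ => trivial)
  refine ⟨W.map altSum, t, (t + t') / 2, ht, by linarith, fun f => ?_, ?_, ?_⟩
  · refine (hW _).2 ((htrue.and_apply_eq f (hU f) []).mono fun q hq => ?_)
    simpa [altSum] using hq.2
  · refine (hW _).2 ((htrue.altSum_norm_le ?_).mono fun q hq => hq.2)
    simp only [altSum, norm_zero]; linarith
  · refine (hW _).2 (.node [] _ ((hU1.and hgap).and (htrue.of_cons hU1 ht)) ?_ ?_)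
    · rintro x ⟨⟨hx, -⟩, -⟩
      simpa [altSum, hx] using ht
    · rintro x ⟨⟨-, hx⟩, hg⟩
      obtain ⟨h, hh⟩ := exists_weakStar_limit W (fun l => F (x - altSum l)) 1 fun l => (hF _).1
      refine (hg.and_apply_eq h (hU h) []).mono fun q hq => ?_
      have hq0 : h (altSum q - x) = 0 := by
        have := hq.2
        simp [altSum] at this
        simp [this]
      have hlim := hh (altSum q - x)
      rw [hq0] at hlim
      have hev : ∀ᶠ l in (W : Filter (List X)), (t + t') / 2 ≤ ‖altSum q - altSum l‖ := by
        filter_upwards [hlim.eventually_const_lt (show -((t' - t) / 2) < 0 by linarith),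
          (hW _).2 hx] with l hl hxl
        have h1 := (le_abs_self _).trans
          ((F (x - altSum l)).le_of_opNorm_le (hF _).1 (altSum q - altSum l))
        have h2 : altSum q - altSum l = (altSum q - x) + (x - altSum l) := by abel
        have h3 : F (x - altSum l) (altSum q - altSum l) =
            F (x - altSum l) (altSum q - x) + ‖x - altSum l‖ := by
          rw [h2, map_add, (hF _).2]
        linarith
      exact hev

theorem exists_seq_of_eventually₃ {α : Type*} (Z : Filter α) [Z.NeBot] (R : α → α → α → Prop)
    (hR : ∀ᶠ a in Z, ∀ᶠ b in Z, ∀ᶠ c in Z, R a b c) :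
    ∃ y : ℕ → α, ∀ i j k, i < j → j < k → R (y i) (y j) (y k) := by
  classical
  obtain ⟨u, hu, hlt⟩ := exists_seq_of_forall_finset_exists (α := Finset α × α)
    (fun w => (∀ᶠ b in Z, ∀ᶠ c in Z, R w.2 b c) ∧ (∀ a ∈ w.1, ∀ᶠ c in Z, R a w.2 c) ∧
      ∀ a ∈ w.1, ∀ b ∈ w.1, (∀ᶠ c in Z, R a b c) → R a b w.2)
    (fun w w' => w.2 ∈ w'.1) (by
      intro T hT
      have h2 : ∀ᶠ y in Z, ∀ a ∈ T.image Prod.snd, ∀ᶠ c in Z, R a y c := by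
        rw [eventually_all_finset]
        intro a ha
        obtain ⟨w, hw, rfl⟩ := Finset.mem_image.1 ha
        exact (hT w hw).1
      have h3 : ∀ᶠ y in Z, ∀ a ∈ T.image Prod.snd, ∀ b ∈ T.image Prod.snd,
          (∀ᶠ c in Z, R a b c) → R a b y := by
        rw [eventually_all_finset]
        intro a _
        rw [eventually_all_finset]
        intro b _
        by_cases hab : ∀ᶠ c in Z, R a b c
        · exact hab.mono fun _ hc _ => hc
        · exact Eventually.of_forall fun _ h => absurd h hab
      obtain ⟨y, hy1, hy2, hy3⟩ := (hR.and (h2.and h3)).exists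
      exact ⟨(T.image Prod.snd, y), ⟨hy1, hy2, hy3⟩, fun w hw => Finset.mem_image_of_mem _ hw⟩)
  exact ⟨fun n => (u n).2, fun i j k hij hjk =>
    (hu k).2.2 _ (hlt i k (hij.trans hjk)) _ (hlt j k hjk) ((hu j).2.1 _ (hlt i j hij))⟩

theorem exists_infinite_bsa_of_ultrafilter {Z : Ultrafilter X} {t d : ℝ} (ht : 0 < t)
    (htd : t < d) (hZ : ∀ f : X →L[ℝ] ℝ, ∀ᶠ z in (Z : Filter X), f z = 0)
    (hZt : ∀ᶠ z in (Z : Filter X), ‖z‖ ≤ t)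
    (hZd : ∀ᶠ y in (Z : Filter X), ∀ᶠ z in (Z : Filter X), d ≤ ‖y - z‖) :
    ∃ S : Set X, S.Infinite ∧ IsBSA X S 1 1 (d / t) := by
  obtain ⟨F, hF⟩ := exists_norming (X := X)
  choose h hh using fun y =>
    exists_weakStar_limit Z (fun z => F (y - z)) 1 fun z => (hF _).1
  have hnorm : ∀ y, ‖h y‖ ≤ 1 := fun y =>
    ContinuousLinearMap.opNorm_le_bound _ zero_le_one fun v =>
      le_of_tendsto (hh y v).norm
        (Eventually.of_forall fun z => (F (y - z)).le_of_opNorm_le (hF _).1 v)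
  obtain ⟨g, hg⟩ := exists_weakStar_limit Z h 1 hnorm
  have hδ : 0 < d - t := sub_pos.2 htd
  obtain ⟨y, hy⟩ := exists_seq_of_eventually₃ (Z : Filter X)
    (fun a b c => ‖a‖ ≤ t ∧ d ≤ ‖a - b‖ ∧ |F (a - b) c| ≤ d - t ∧ |F (a - c) b| ≤ d - t ∧
      |F (b - c) a| ≤ d - t) (by
    filter_upwards [hZt, hZd, hZ g] with a hat had hga
    have hlim := (hg a).abs
    rw [hga, abs_zero] at hlim
    filter_upwards [had, hZ (h a), hlim.eventually_lt_const hδ] with b hab hhb hba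
    have h1 := (hh a b).abs
    rw [hhb, abs_zero] at h1
    filter_upwards [hZ (F (a - b)), h1.eventually_le_const hδ,
      (hh b a).abs.eventually_le_const hba] with c hc1 hc2 hc3
    exact ⟨hat, hab, by rw [hc1, abs_zero]; exact hδ.le, hc2, hc3⟩)
  have hyt : ∀ i, ‖y i‖ ≤ t := fun i =>
    (hy i (i + 1) (i + 2) (by omega) (by omega)).1
  have hyd : ∀ i j, i < j → d ≤ ‖y i - y j‖ := fun i j hij =>
    (hy i j (j + 1) hij (by omega)).2.1
  have hbd : ∀ i j k, |F (y i - y j) (y k)| ≤ t := fun i j k =>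
    ((F _).le_of_opNorm_le (hF _).1 (y k)).trans (by simpa using hyt k)
  have hsep : ∀ i j, i < j → d ≤ F (y i - y j) (y i) - F (y i - y j) (y j) := by
    intro i j hij
    rw [← map_sub, (hF _).2]
    exact hyd i j hij
  have hbetween : ∀ i j, i < j → ∀ k,
      F (y i - y j) (y j) ≤ F (y i - y j) (y k) ∧
        F (y i - y j) (y k) ≤ F (y i - y j) (y i) := by
    intro i j hij k
    have h1 := hsep i j hij
    have h2 := abs_le.1 (hbd i j i)
    have h3 := abs_le.1 (hbd i j j)
    by_cases hki : k = i
    · subst hki; constructor <;> linarith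
    by_cases hkj : k = j
    · subst hkj; constructor <;> linarith
    have h4 : |F (y i - y j) (y k)| ≤ d - t := by
      rcases lt_or_gt_of_ne hki with hki | hki
      · exact (hy k i j hki hij).2.2.2.2
      rcases lt_or_gt_of_ne hkj with hkj | hkj
      · exact (hy i k j hki hkj).2.2.2.1
      · exact (hy i j k hij hkj).2.2.1
    have h5 := abs_le.1 h4
    constructor <;> linarith
  have hinj : Function.Injective fun n => t⁻¹ • y n := by
    intro i j hij
    have hij' : y i = y j := smul_right_injective X (inv_ne_zero ht.ne') hij
    rcases lt_trichotomy i j with hlt | heq | hlt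
    · have := hyd i j hlt
      rw [hij', sub_self, norm_zero] at this
      linarith
    · exact heq
    · have := hyd j i hlt
      rw [hij', sub_self, norm_zero] at this
      linarith
  refine ⟨range fun n => t⁻¹ • y n, infinite_range_of_injective hinj, ?_, ?_⟩
  · rintro _ ⟨n, rfl⟩
    rw [norm_smul, norm_inv, Real.norm_of_nonneg ht.le, inv_mul_le_iff₀ ht, mul_one]
    exact hyt n
  · rintro _ ⟨i, rfl⟩ _ ⟨j, rfl⟩ hne
    have hij : i ≠ j := fun h => hne (by rw [h])
    have hinv : 0 < t⁻¹ := inv_pos.2 ht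
    rcases lt_or_gt_of_ne hij with hlt | hlt
    · refine ⟨-F (y i - y j), by rw [norm_neg]; exact (hF _).1, ?_, ?_⟩
      · have := mul_le_mul_of_nonneg_left (hsep i j hlt) hinv.le
        simp only [neg_apply, map_smul, smul_eq_mul, div_eq_inv_mul]
        linarith
      · rintro _ ⟨k, rfl⟩
        obtain ⟨h1, h2⟩ := hbetween i j hlt k
        simp only [neg_apply, map_smul, smul_eq_mul]
        exact ⟨mul_le_mul_of_nonneg_left (neg_le_neg h2) hinv.le,
          mul_le_mul_of_nonneg_left (neg_le_neg h1) hinv.le⟩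
    · refine ⟨F (y j - y i), (hF _).1, ?_, ?_⟩
      · have := mul_le_mul_of_nonneg_left (hsep j i hlt) hinv.le
        simp only [map_smul, smul_eq_mul, div_eq_inv_mul]
        linarith
      · rintro _ ⟨k, rfl⟩
        obtain ⟨h1, h2⟩ := hbetween j i hlt k
        simp only [map_smul, smul_eq_mul]
        exact ⟨mul_le_mul_of_nonneg_left h1 hinv.le, mul_le_mul_of_nonneg_left h2 hinv.le⟩

theorem IsBSA.le_two {S : Set X} {d : ℝ} (hS : S.Infinite) (h : IsBSA X S 1 1 d) : d ≤ 2 := by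
  obtain ⟨x, hx, y, hy, hxy⟩ := hS.nontrivial
  obtain ⟨f, hf, hd, -⟩ := h.2 x hx y hy hxy
  have h1 := abs_le.1 ((f.le_of_opNorm_le hf x).trans (by simpa using h.1 x hx))
  have h2 := abs_le.1 ((f.le_of_opNorm_le hf y).trans (by simpa using h.1 y hy))
  linarith [h1.1, h2.2]

end Helpers

/-- For every infinite-dimensional reflexive Banach space X, K_a(X) > 1. -/
theorem stmt11 {X : Type*} [NormedAddCommGroup X] [NormedSpace ℝ X]
    [CompleteSpace X] (hinf : ¬FiniteDimensional ℝ X)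
    (hrefl : Function.Surjective (NormedSpace.inclusionInDoubleDual ℝ X)) :
    1 < Ka X ∧ ∃ S : Set X, S.Infinite ∧ ∃ d : ℝ, 1 < d ∧ IsBSA X S 1 1 d := by
  obtain ⟨Z, t, d, ht, htd, hZ, hZt, hZd⟩ := exists_separated_ultrafilter hinf hrefl
  have ht0 : 0 < t := by linarith
  obtain ⟨S, hS, hbsa⟩ := exists_infinite_bsa_of_ultrafilter ht0 htd hZ hZt hZd
  have hd : 1 < d / t := (one_lt_div ht0).2 htd
  refine ⟨hd.trans_le (le_csSup ⟨2, ?_⟩ ⟨S, hS, hbsa⟩), S, hS, d / t, hd, hbsa⟩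
  rintro r ⟨T, hT, hr⟩
  exact hr.le_two hT
end
end

section
/- Let X be an infinite-dimensional Banach space with separable dual X*. Then K_a(X) > 1. -/
open Set Filter

noncomputable section

open scoped Topology

/-- The history `[v (n - 1), …, v 0]` of a sequence before time `n`. -/
def hist {α : Type*} (v : ℕ → α) : ℕ → List α
  | 0 => []
  | n + 1 => v n :: hist v n

theorem mem_hist {α : Type*} {v : ℕ → α} {n : ℕ} {a : α} :
    a ∈ hist v n ↔ ∃ k < n, v k = a := by
  induction n with
  | zero => simp [hist]
  | succ n ih =>
    simp only [hist, List.mem_cons, ih]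
    constructor
    · rintro (rfl | ⟨k, hk, rfl⟩)
      · exact ⟨n, by omega, rfl⟩
      · exact ⟨k, by omega, rfl⟩
    · rintro ⟨k, hk, rfl⟩
      rcases Nat.lt_succ_iff_lt_or_eq.1 hk with h | rfl
      · exact Or.inr ⟨k, h, rfl⟩
      · exact Or.inl rfl

theorem length_hist {α : Type*} (v : ℕ → α) (n : ℕ) : (hist v n).length = n := by
  induction n with
  | zero => rfl
  | succ n ih => simp [hist, ih]

theorem sum_hist {α : Type*} [AddCommMonoid α] (v : ℕ → α) (n : ℕ) :
    (hist v n).sum = ∑ k ∈ Finset.range n, v k := by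
  induction n with
  | zero => rfl
  | succ n ih => simp [hist, ih, Finset.sum_range_succ, add_comm]

theorem hist_add {α : Type*} (v : ℕ → α) (i d : ℕ) :
    hist v (i + 1 + d) = hist (fun j => v (i + 1 + j)) d ++ v i :: hist v i := by
  induction d with
  | zero => rfl
  | succ d ih =>
    change v (i + 1 + d) :: hist v (i + 1 + d) = _
    rw [ih]; rfl

/-- Dependent choice along histories. -/
theorem exists_seq_hist {α : Type*} (P : List α → Prop) (Q : List α → α → Prop) (h0 : P [])
    (h : ∀ F, P F → ∃ y, Q F y ∧ P (y :: F)) : ∃ v : ℕ → α, ∀ n, Q (hist v n) (v n) := by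
  choose g hg using fun F : {F // P F} => h F.1 F.2
  let L : ℕ → {F // P F} :=
    fun n => Nat.rec ⟨[], h0⟩ (fun _ F => ⟨g F :: F.1, (hg F).2⟩) n
  have hh : ∀ n, hist (fun n => g (L n)) n = (L n).1 := by
    intro n
    induction n with
    | zero => rfl
    | succ n ih =>
      change g (L n) :: hist (fun n => g (L n)) n = g (L n) :: (L n).1
      rw [ih]
  exact ⟨fun n => g (L n), fun n => by rw [hh]; exact (hg (L n)).1⟩

theorem exists_seq_typical {α : Type*} (V : Ultrafilter α) (Q : List α → α → Prop)
    (h : ∀ F, ∀ᶠ y in V, Q F y) : ∃ v : ℕ → α, ∀ n, Q (hist v n) (v n) :=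
  exists_seq_hist (fun _ => True) Q trivial fun F _ =>
    let ⟨y, hy⟩ := (h F).exists
    ⟨y, hy, trivial⟩

theorem eventually_forall_mem_list {α β : Type*} {l : Filter β} (F : List α)
    {p : α → β → Prop} (h : ∀ a ∈ F, ∀ᶠ b in l, p a b) : ∀ᶠ b in l, ∀ a ∈ F, p a b := by
  induction F with
  | nil => simp
  | cons a F ih =>
    simp only [List.mem_cons, forall_eq_or_imp] at h ⊢
    exact h.1.and (ih h.2)

section Convolution

variable {X : Type*} [AddCommGroup X]

/-- The sum of two ultrafilters. -/
def conv (V W : Ultrafilter X) : Ultrafilter X :=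
  V.bind fun v => W.map (v + ·)

/-- The reflection of an ultrafilter. -/
def reflect (V : Ultrafilter X) : Ultrafilter X :=
  V.map (- ·)

theorem eventually_conv {V W : Ultrafilter X} {p : X → Prop} :
    (∀ᶠ x in conv V W, p x) ↔ ∀ᶠ v in V, ∀ᶠ w in W, p (v + w) :=
  Iff.rfl

theorem eventually_reflect {V : Ultrafilter X} {p : X → Prop} :
    (∀ᶠ x in reflect V, p x) ↔ ∀ᶠ v in V, p (-v) :=
  Iff.rfl

theorem conv_assoc (U V W : Ultrafilter X) : conv (conv U V) W = conv U (conv V W) :=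
  Ultrafilter.coe_inj.mp <| Filter.ext' fun p => by
    simp [eventually_conv, add_assoc]

theorem reflect_conv (V W : Ultrafilter X) :
    reflect (conv V W) = conv (reflect V) (reflect W) :=
  Ultrafilter.coe_inj.mp <| Filter.ext' fun p => by
    simp only [eventually_conv, eventually_reflect, neg_add]

theorem reflect_reflect (V : Ultrafilter X) : reflect (reflect V) = V :=
  Ultrafilter.coe_inj.mp <| Filter.ext' fun p => by
    simp only [eventually_reflect, neg_neg]

end Convolution

section WeakLimits

variable {X : Type*} [NormedAddCommGroup X] [NormedSpace ℝ X]

/-- An ultrafilter on `X` converging to `0` weakly. -/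
def WeaklyNull (V : Ultrafilter X) : Prop :=
  ∀ f : X →L[ℝ] ℝ, Tendsto f V (𝓝 0)

/-- The norm along `V` is asymptotically at most `c`. -/
def NormLE (V : Ultrafilter X) (c : ℝ) : Prop :=
  ∀ c' > c, ∀ᶠ v : X in V, ‖v‖ < c'

theorem WeaklyNull.eventually_lt {V : Ultrafilter X} (hV : WeaklyNull V) (f : X →L[ℝ] ℝ)
    {ε : ℝ} (hε : 0 < ε) : ∀ᶠ v in V, |f v| < ε := by
  have := (hV f).eventually (Metric.ball_mem_nhds 0 hε)
  simpa [Real.norm_eq_abs] using this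

theorem weaklyNull_of_forall {V : Ultrafilter X}
    (h : ∀ (f : X →L[ℝ] ℝ) (ε : ℝ), 0 < ε → ∀ᶠ v in V, |f v| < ε) : WeaklyNull V := by
  intro f
  rw [Metric.tendsto_nhds]
  intro ε hε
  simpa [Real.norm_eq_abs] using h f ε hε

theorem WeaklyNull.reflect {V : Ultrafilter X} (hV : WeaklyNull V) : WeaklyNull (reflect V) :=
  weaklyNull_of_forall fun f ε hε => eventually_reflect.2 <| by
    simpa using hV.eventually_lt f hε

theorem WeaklyNull.conv {V W : Ultrafilter X} (hV : WeaklyNull V) (hW : WeaklyNull W) :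
    WeaklyNull (conv V W) :=
  weaklyNull_of_forall fun f ε hε => eventually_conv.2 <| by
    filter_upwards [hV.eventually_lt f (half_pos hε)] with v hv
    filter_upwards [hW.eventually_lt f (half_pos hε)] with w hw
    rw [map_add]
    exact (abs_add_le _ _).trans_lt (by linarith)

/-- Banach–Alaoglu for ultralimits. -/
theorem exists_weak_limit {ι : Type*} (W : Ultrafilter ι) (φ : ι → X →L[ℝ] ℝ)
    (hφ : ∀ i, ‖φ i‖ ≤ 1) :
    ∃ f : X →L[ℝ] ℝ, ‖f‖ ≤ 1 ∧ ∀ x, Tendsto (fun i => φ i x) W (𝓝 (f x)) := by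
  have hc := WeakDual.isCompact_closedBall (𝕜 := ℝ) (E := X) 0 1
  obtain ⟨g, hg, hle⟩ := hc.ultrafilter_le_nhds
    (W.map fun i => StrongDual.toWeakDual (φ i)) (by
      rw [Filter.le_principal_iff]
      refine Filter.mem_map.2 (Filter.univ_mem' fun i => ?_)
      simpa using hφ i)
  refine ⟨WeakDual.toStrongDual g, by simpa using hg, fun x => ?_⟩
  have h1 : Tendsto (fun i => StrongDual.toWeakDual (φ i)) W (𝓝 g) := hle
  exact ((WeakDual.eval_continuous x).tendsto g).comp h1

/-- Weak lower semicontinuity of ultralimits of norms. -/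
theorem WeaklyNull.drop {ι : Type*} {V : Ultrafilter X} (hV : WeaklyNull V) (W : Ultrafilter ι)
    (h : ι → X) {b c : ℝ} (hbc : b < c) (hb : ∀ᶠ v in V, ∀ᶠ w in W, ‖v + h w‖ < b) :
    ∀ᶠ w in W, ‖h w‖ < c := by
  choose φ hφ1 hφ using fun w => exists_dual_vector'' ℝ (h w)
  obtain ⟨f, -, hf⟩ := exists_weak_limit W φ hφ1
  have hε : 0 < (c - b) / 2 := by linarith
  obtain ⟨v, hv, hvf⟩ := (hb.and (hV.eventually_lt f hε)).exists
  filter_upwards [hv, (hf v).eventually (Metric.ball_mem_nhds _ hε)] with w hw hw'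
  have h1 : φ w (v + h w) ≤ ‖v + h w‖ :=
    (le_abs_self _).trans ((φ w).le_of_opNorm_le (hφ1 w) _ |>.trans (by simp))
  rw [map_add, hφ] at h1
  simp only [RCLike.ofReal_real_eq_id, id_eq] at h1
  rw [Real.dist_eq, abs_lt] at hw'
  rw [abs_lt] at hvf
  linarith

theorem NormLE.drop_left {V W : Ultrafilter X} {c : ℝ} (hV : WeaklyNull V)
    (h : NormLE (conv V W) c) : NormLE W c := by
  intro c' hc'
  obtain ⟨b, hb, hb'⟩ := exists_between hc'
  exact hV.drop W id hb' (eventually_conv.1 (h b hb))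

theorem NormLE.drop_right {V W : Ultrafilter X} {c : ℝ} (hW : WeaklyNull W)
    (h : NormLE (conv V W) c) : NormLE V c := by
  intro c' hc'
  obtain ⟨b, hb, hb'⟩ := exists_between hc'
  filter_upwards [eventually_conv.1 (h b hb)] with v hv
  obtain ⟨-, h'⟩ := (hW.drop (pure ()) (fun _ => v) hb' (by
    filter_upwards [hv] with w hw
    refine Filter.Eventually.of_forall fun _ => ?_
    rwa [add_comm])).exists
  exact h'

theorem NormLE.drop_middle {A V B : Ultrafilter X} {c : ℝ} (hV : WeaklyNull V)
    (h : NormLE (conv A (conv V B)) c) : NormLE (conv A B) c := by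
  intro c' hc'
  obtain ⟨b, hb, hb'⟩ := exists_between hc'
  have hb1 := h b hb
  simp only [eventually_conv] at hb1 ⊢
  filter_upwards [hb1] with a ha
  refine hV.drop B (a + ·) hb' ?_
  simpa only [add_left_comm] using ha

/-- If reflected sums do not increase norms, then neither do the first three terms of
the corresponding eightfold sums. -/
theorem normLE_three {V : Ultrafilter X} {R : ℝ} (hV : WeaklyNull V) (hR : NormLE V R)
    (hA : ∀ W : Ultrafilter X, WeaklyNull W → NormLE W R → NormLE (conv W (reflect W)) R) :
    NormLE (conv V (conv V V)) R ∧ NormLE (conv V (conv V (reflect V))) R := by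
  have hn := hV.reflect
  have h1 := hA V hV hR
  have w1 := hV.conv hn
  have h2 := hA _ w1 h1
  have w2 := w1.conv w1.reflect
  have h3 := hA _ w2 h2
  simp only [reflect_conv, reflect_reflect, conv_assoc] at h3
  have h4 := NormLE.drop_middle hn (NormLE.drop_middle hn h3)
  rw [← conv_assoc] at h4
  have h5 := NormLE.drop_middle hn h4
  rw [conv_assoc] at h5
  refine ⟨?_, ?_⟩
  · rw [← conv_assoc V V, ← conv_assoc, ← conv_assoc] at h5
    have := NormLE.drop_right hn h5
    rw [conv_assoc, conv_assoc] at this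
    exact NormLE.drop_left hV this
  · exact NormLE.drop_left hV (NormLE.drop_left hV h5)

/-- The unit sphere of an infinite-dimensional space is weakly dense at the origin. -/
theorem exists_weaklyNull_sphere (hinf : ¬FiniteDimensional ℝ X) :
    ∃ V : Ultrafilter X, WeaklyNull V ∧ ∀ᶠ v : X in V, ‖v‖ = 1 := by
  classical
  let K : Finset (X →L[ℝ] ℝ) → Set X := fun t => {x | ‖x‖ = 1 ∧ ∀ f ∈ t, f x = 0}
  have hK : ∀ t, (K t).Nonempty := by
    intro t
    let T : X →ₗ[ℝ] (t → ℝ) := LinearMap.pi fun f => (f.1 : X →ₗ[ℝ] ℝ)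
    have hT : ¬Function.Injective T := fun h => hinf (FiniteDimensional.of_injective T h)
    rw [← LinearMap.ker_eq_bot, Submodule.eq_bot_iff] at hT
    push Not at hT
    obtain ⟨x, hx, hx0⟩ := hT
    refine ⟨‖x‖⁻¹ • x, ?_, fun f hf => ?_⟩
    · rw [norm_smul, norm_inv, norm_norm, inv_mul_cancel₀ (norm_ne_zero_iff.2 hx0)]
    · have : f x = 0 := congrFun (LinearMap.mem_ker.1 hx) ⟨f, hf⟩
      simp [this]
  have hne : (⨅ t, 𝓟 (K t)).NeBot := by
    refine iInf_neBot_of_directed' ?_ fun t => (hK t).principal_neBot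
    intro s t
    refine ⟨s ∪ t, ?_, ?_⟩ <;> refine principal_mono.2 fun x hx => ⟨hx.1, fun f hf => hx.2 f ?_⟩
    · exact Finset.mem_union_left _ hf
    · exact Finset.mem_union_right _ hf
  let V := Ultrafilter.of (⨅ t, 𝓟 (K t))
  have hV : ∀ t, ∀ᶠ x in V, x ∈ K t := fun t =>
    Ultrafilter.of_le _ (mem_iInf_of_mem t (mem_principal_self _))
  refine ⟨V, weaklyNull_of_forall fun f ε hε => ?_, (hV ∅).mono fun x hx => hx.1⟩
  filter_upwards [hV {f}] with x hx
  rw [hx.2 f (by simp)]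
  simpa using hε

end WeakLimits

section Antipodal

variable {X : Type*} [NormedAddCommGroup X] [NormedSpace ℝ X]

theorem exists_bsa_of_seq {y : ℕ → X} {a b d : ℝ} (ha : 0 < a) (hb : 0 < b) (hd : 0 < d)
    (hy : ∀ n, ‖y n‖ ≤ a)
    (hf : ∀ m n, m < n → ∃ f : X →L[ℝ] ℝ, ‖f‖ ≤ b ∧ d ≤ f (y m) - f (y n) ∧
      ∀ k, f (y n) ≤ f (y k) ∧ f (y k) ≤ f (y m)) :
    ∃ S : Set X, S.Infinite ∧ IsBSA X S 1 1 (d / (a * b)) := by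
  have key : ∀ m n, m ≠ n → ∃ f : X →L[ℝ] ℝ, ‖f‖ ≤ b ∧ d ≤ f (y n) - f (y m) ∧
      ∀ k, f (y m) ≤ f (y k) ∧ f (y k) ≤ f (y n) := by
    intro m n hmn
    rcases lt_or_gt_of_ne hmn with h | h
    · obtain ⟨f, h1, h2, h3⟩ := hf m n h
      refine ⟨-f, by rwa [norm_neg], ?_, fun k => ?_⟩
      · simp only [neg_apply]; linarith
      · simp only [neg_apply]
        exact ⟨neg_le_neg (h3 k).2, neg_le_neg (h3 k).1⟩
    · exact hf n m h
  have hinj : Function.Injective fun n => a⁻¹ • y n := by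
    intro m n hmn
    by_contra hne
    obtain ⟨f, -, h2, -⟩ := key m n hne
    have : y m = y n := smul_right_injective X (inv_ne_zero ha.ne') hmn
    rw [this] at h2
    linarith
  refine ⟨Set.range fun n => a⁻¹ • y n, Set.infinite_range_of_injective hinj, ?_, ?_⟩
  · rintro _ ⟨n, rfl⟩
    simp only [norm_smul, norm_inv, Real.norm_of_nonneg ha.le]
    rw [inv_mul_le_iff₀ ha, mul_one]
    exact hy n
  · rintro _ ⟨m, rfl⟩ _ ⟨n, rfl⟩ hmn
    obtain ⟨f, h1, h2, h3⟩ := key m n (by rintro rfl; exact hmn rfl)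
    have hab : 0 ≤ b⁻¹ * a⁻¹ := by positivity
    have hsc : ∀ k, (b⁻¹ • f) (a⁻¹ • y k) = b⁻¹ * a⁻¹ * f (y k) := by
      intro k; simp [mul_assoc, mul_left_comm]
    refine ⟨b⁻¹ • f, ?_, ?_, ?_⟩
    · simp only [norm_smul, norm_inv, Real.norm_of_nonneg hb.le]
      rw [inv_mul_le_iff₀ hb, mul_one]
      exact h1
    · simp only [hsc]
      rw [← mul_sub, div_eq_inv_mul, mul_inv_rev]
      exact mul_le_mul_of_nonneg_left h2 hab
    · rintro _ ⟨k, rfl⟩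
      simp only [hsc]
      exact ⟨mul_le_mul_of_nonneg_left (h3 k).1 hab, mul_le_mul_of_nonneg_left (h3 k).2 hab⟩

/-- A weakly null ultrafilter whose members are typically `d`-separated yields an antipodal set. -/
theorem exists_bsa_of_separated {V : Ultrafilter X} (hV : WeaklyNull V) {ρ d : ℝ} (hρ : 0 < ρ)
    (hρd : ρ < d) (hb : ∀ᶠ v : X in V, ‖v‖ ≤ ρ) (hs : ∀ᶠ v : X in V, ∀ᶠ w : X in V, d ≤ ‖v - w‖) :
    ∃ S : Set X, S.Infinite ∧ IsBSA X S 1 1 (d / ρ) := by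
  choose φ hφ1 hφ using fun v w : X => exists_dual_vector'' ℝ (v - w)
  choose ψ hψ1 hψ using fun v => exists_weak_limit V (φ v) (hφ1 v)
  obtain ⟨χ, -, hχ⟩ := exists_weak_limit V ψ hψ1
  obtain ⟨η, hη, hηd⟩ : ∃ η > 0, 3 * η = d - ρ := ⟨(d - ρ) / 3, by linarith, by ring⟩
  have close : ∀ {g : X → ℝ} {L : ℝ}, Tendsto g V (𝓝 L) → ∀ᶠ x in V, |g x - L| < η :=
    fun h => h.eventually (Metric.ball_mem_nhds _ hη)
  obtain ⟨v, hv⟩ := exists_seq_typical V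
    (fun F x => ‖x‖ ≤ ρ ∧ (∀ᶠ w in V, d ≤ ‖x - w‖) ∧
      (∀ v ∈ F, (∀ᶠ w in V, d ≤ ‖v - w‖) → d ≤ ‖v - x‖) ∧ |χ x| < η ∧
      (∀ v ∈ F, |ψ v x| < η) ∧ (∀ v ∈ F, |ψ x v - χ v| < η) ∧
      (∀ v ∈ F, ∀ w ∈ F, |φ v w x| < η) ∧ ∀ v ∈ F, ∀ w ∈ F, |φ v x w - ψ v w| < η)
    (by
      intro F
      refine hb.and (hs.and ((eventually_forall_mem_list F fun v _ => ?_).and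
        ((hV.eventually_lt χ hη).and
        ((eventually_forall_mem_list F fun v _ => hV.eventually_lt (ψ v) hη).and
        ((eventually_forall_mem_list F fun v _ => close (hχ v)).and
        ((eventually_forall_mem_list F fun v _ => eventually_forall_mem_list F fun w _ =>
          hV.eventually_lt (φ v w) hη).and
        (eventually_forall_mem_list F fun v _ => eventually_forall_mem_list F fun w _ =>
          close (hψ v w))))))))
      by_cases h : ∀ᶠ w in V, d ≤ ‖v - w‖
      · exact h.mono fun w hw _ => hw
      · exact Eventually.of_forall fun w hw => absurd hw h)
  have hm : ∀ {m n}, m < n → v m ∈ hist v n := fun h => mem_hist.2 ⟨_, h, rfl⟩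
  rw [← mul_one ρ]
  refine exists_bsa_of_seq (y := v) hρ one_pos (hρ.trans hρd) (fun n => (hv n).1) fun m n hmn =>
    ⟨φ (v m) (v n), hφ1 _ _, ?_⟩
  have hbd : ∀ k, |φ (v m) (v n) (v k)| ≤ ρ := fun k =>
    ((φ (v m) (v n)).le_of_opNorm_le (hφ1 _ _) _).trans (by simpa using (hv k).1)
  have hsep : d ≤ φ (v m) (v n) (v m) - φ (v m) (v n) (v n) := by
    rw [← map_sub, hφ]
    exact (hv n).2.2.1 _ (hm hmn) (hv m).2.1
  refine ⟨hsep, fun k => ?_⟩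
  have hbm := abs_le.1 (hbd m)
  have hbn := abs_le.1 (hbd n)
  rcases eq_or_ne k m with rfl | hkm
  · exact ⟨by linarith, le_rfl⟩
  rcases eq_or_ne k n with rfl | hkn
  · exact ⟨le_rfl, by linarith⟩
  have hsmall : |φ (v m) (v n) (v k)| < 3 * η := by
    rcases lt_or_gt_of_ne hkn with hkn | hkn
    · have h1 := abs_lt.1 ((hv n).2.2.2.2.2.2.2 _ (hm hmn) _ (hm hkn))
      rcases lt_or_gt_of_ne hkm with hkm | hkm
      · have h2 := abs_lt.1 ((hv m).2.2.2.2.2.1 _ (hm hkm))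
        have h3 := abs_lt.1 (hv k).2.2.2.1
        rw [abs_lt]; constructor <;> linarith
      · have h2 := abs_lt.1 ((hv k).2.2.2.2.1 _ (hm hkm))
        rw [abs_lt]; constructor <;> linarith
    · have h1 := (hv k).2.2.2.2.2.2.1 _ (hm (hmn.trans hkn)) _ (hm hkn)
      linarith
  rw [abs_lt] at hsmall
  constructor <;> linarith

theorem normLE_conv_reflect
    (hno : ∀ d > 1, ¬∃ S : Set X, S.Infinite ∧ IsBSA X S 1 1 d) {R : ℝ} (hR : 0 < R)
    {V : Ultrafilter X} (hV : WeaklyNull V) (hVR : NormLE V R) :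
    NormLE (conv V (reflect V)) R := by
  intro c hc
  by_contra hcon
  obtain ⟨ρ, hρ, hρc⟩ := exists_between hc
  rw [← Ultrafilter.frequently_iff_eventually, Filter.not_frequently] at hcon
  refine hno (c / ρ) ((one_lt_div (hR.trans hρ)).2 hρc)
    (exists_bsa_of_separated hV (hR.trans hρ) hρc ((hVR ρ hρ).mono fun _ h => h.le) ?_)
  simp only [eventually_conv, eventually_reflect, not_lt, ← sub_eq_add_neg] at hcon
  exact hcon

/-- A sequence of unit vectors with uniformly bounded signed partial sums, generic enough for
its norming functionals to be almost biorthogonal, yields an antipodal set. -/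
theorem exists_bsa_of_partial_sums {V : Ultrafilter X} (hV : WeaklyNull V)
    (h1 : ∀ᶠ v : X in V, ‖v‖ = 1)
    (h : ∀ U : List X → X → Prop, (∀ F, ∀ᶠ x in V, U F x) → ∃ v : ℕ → X, ∀ n,
      U (hist v n) (v n) ∧ ‖(hist v n).sum - v n‖ ≤ 11 / 10) :
    ∃ S : Set X, S.Infinite ∧ IsBSA X S 1 1 (3 / 2) := by
  choose φ hφ1 hφ using fun v : X => exists_dual_vector'' ℝ v
  obtain ⟨χ, -, hχ⟩ := exists_weak_limit V φ hφ1
  let ε : ℕ → ℝ := fun n => 1 / 160 * (1 / 2) ^ n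
  have hε : ∀ n, 0 < ε n := fun n => by positivity
  obtain ⟨v, hv⟩ := h
    (fun F x => ‖x‖ = 1 ∧ |χ x| < ε F.length ∧ (∀ v ∈ F, |φ v x| < ε F.length) ∧
      ∀ v ∈ F, |φ x v - χ v| < ε F.length)
    (fun F => h1.and ((hV.eventually_lt χ (hε _)).and
      ((eventually_forall_mem_list F fun v _ => hV.eventually_lt (φ v) (hε _)).and
      (eventually_forall_mem_list F fun v _ =>
        (hχ v).eventually (Metric.ball_mem_nhds _ (hε _))))))
  simp only [length_hist, sum_hist] at hv
  have hm : ∀ {m n}, m < n → v m ∈ hist v n := fun h => mem_hist.2 ⟨_, h, rfl⟩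
  have hεanti : ∀ {m n}, m ≤ n → ε n ≤ ε m := fun h =>
    mul_le_mul_of_nonneg_left (pow_le_pow_of_le_one (by norm_num) (by norm_num) h) (by norm_num)
  have hone : ∀ m, φ (v m) (v m) = 1 := fun m => by rw [hφ, (hv m).1.1]; simp
  have hoff : ∀ m k, k ≠ m → |φ (v m) (v k)| ≤ 2 * ε k := by
    intro m k hkm
    rcases lt_or_gt_of_ne hkm with h | h
    · have a1 := abs_lt.1 ((hv m).1.2.2.2 _ (hm h))
      have a2 := abs_lt.1 (hv k).1.2.1
      have a3 := hεanti h.le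
      rw [abs_le]; constructor <;> linarith
    · have a1 := (hv k).1.2.2.1 _ (hm h)
      have := hε k
      linarith
  have hsum : ∀ n, ∑ k ∈ Finset.range n, 2 * ε k ≤ 1 / 40 - 2 * ε n := by
    intro n
    suffices ∑ k ∈ Finset.range n, 2 * ε k ≤ 1 / 40 - 4 * ε n by
      have := hε n
      linarith
    induction n with
    | zero => norm_num [ε]
    | succ n ih =>
      rw [Finset.sum_range_succ]
      have : ε (n + 1) = ε n / 2 := by simp only [ε]; ring
      linarith
  let y : ℕ → X := fun n => ∑ k ∈ Finset.range n, v k - v n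
  have hlt : ∀ m n, n < m → |φ (v m) (y n)| ≤ 1 / 40 := by
    intro m n hnm
    simp only [y, map_sub, map_sum]
    have a1 : |∑ k ∈ Finset.range n, φ (v m) (v k)| ≤ ∑ k ∈ Finset.range n, 2 * ε k :=
      (Finset.abs_sum_le_sum_abs _ _).trans (Finset.sum_le_sum fun k hk =>
        hoff m k ((Finset.mem_range.1 hk).trans hnm).ne)
    have a2 := hoff m n hnm.ne
    have a3 := hsum n
    exact (abs_sub _ _).trans (by linarith)
  have heq : ∀ m, |φ (v m) (y m) + 1| ≤ 1 / 40 := by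
    intro m
    simp only [y, map_sub, map_sum, hone, sub_add_cancel]
    have a1 : |∑ k ∈ Finset.range m, φ (v m) (v k)| ≤ ∑ k ∈ Finset.range m, 2 * ε k :=
      (Finset.abs_sum_le_sum_abs _ _).trans (Finset.sum_le_sum fun k hk =>
        hoff m k (Finset.mem_range.1 hk).ne)
    have a3 := hsum m
    have := hε m
    linarith
  have hgt : ∀ m n, m < n → |φ (v m) (y n) - 1| ≤ 1 / 40 := by
    intro m n hmn
    simp only [y, map_sub, map_sum]
    have hmem : m ∈ Finset.range n := Finset.mem_range.2 hmn
    rw [← Finset.add_sum_erase _ _ hmem, hone]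
    have a1 : |∑ k ∈ (Finset.range n).erase m, φ (v m) (v k)| ≤
        ∑ k ∈ (Finset.range n).erase m, 2 * ε k :=
      (Finset.abs_sum_le_sum_abs _ _).trans (Finset.sum_le_sum fun k hk =>
        hoff m k (Finset.ne_of_mem_erase hk))
    have a2 := hoff m n hmn.ne'
    have a3 := hsum n
    have a4 : ∑ k ∈ (Finset.range n).erase m, 2 * ε k ≤ ∑ k ∈ Finset.range n, 2 * ε k :=
      Finset.sum_le_sum_of_subset_of_nonneg (Finset.erase_subset _ _) fun k _ _ => by
        have := hε k
        positivity
    rw [abs_le] at a1 a2 ⊢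
    constructor <;> linarith
  obtain ⟨S, hS, hSb, hSa⟩ := exists_bsa_of_seq (y := y) (a := 11 / 10) (b := 11 / 10)
    (d := 3 / 2 * (11 / 10 * (11 / 10))) (by norm_num) (by norm_num) (by norm_num)
    (fun n => (hv n).2) fun m n hmn => by
      refine ⟨(1 / 10 : ℝ) • φ (v n) - φ (v m), ?_, ?_⟩
      · refine (norm_sub_le _ _).trans ?_
        rw [norm_smul]
        have b1 := hφ1 (v n)
        have b2 := hφ1 (v m)
        norm_num
        linarith
      · have c1 := abs_le.1 (heq m)
        have c2 := abs_le.1 (heq n)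
        have c3 := abs_le.1 (hgt m n hmn)
        have c4 := abs_le.1 (hlt n m hmn)
        simp only [sub_apply, smul_apply, smul_eq_mul]
        refine ⟨by linarith, fun k => ?_⟩
        rcases lt_trichotomy k m with hk | rfl | hk
        · have d1 := abs_le.1 (hlt m k hk)
          have d2 := abs_le.1 (hlt n k (hk.trans hmn))
          constructor <;> linarith
        · constructor <;> linarith
        · have d1 := abs_le.1 (hgt m k hk)
          rcases lt_trichotomy k n with hk' | rfl | hk'
          · have d2 := abs_le.1 (hlt n k hk')
            constructor <;> linarith
          · constructor <;> linarith
          · have d2 := abs_le.1 (hgt n k hk')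
            constructor <;> linarith
  rw [mul_div_assoc, div_self (by norm_num), mul_one] at hSa
  exact ⟨S, hS, hSb, hSa⟩

end Antipodal

section Tree

variable {X : Type*} [NormedAddCommGroup X]

/-- The vector `y` may be appended to the history `F`, keeping signed sums bounded by `c`. -/
def GoodStep (U : List X → X → Prop) (c : ℝ) (F : List X) (y : X) : Prop :=
  U F y ∧ ‖F.sum + y‖ ≤ c ∧ ‖F.sum - y‖ ≤ c

/-- `W` describes the sum of a typical continuation of the history `F` by good steps, carried
on for as long as typical vectors are good steps. -/
inductive IsRemainder (V : Ultrafilter X) (U : List X → X → Prop) (c : ℝ) :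
    List X → Ultrafilter X → Prop
  | leaf (F : List X) (h : ¬∀ᶠ y in V, GoodStep U c F y) : IsRemainder V U c F (pure 0)
  | node (F : List X) (W : X → Ultrafilter X) (h : ∀ᶠ y in V, GoodStep U c F y)
      (hW : ∀ y, GoodStep U c F y → IsRemainder V U c (y :: F) (W y)) :
      IsRemainder V U c F (V.bind fun y => (W y).map (y + ·))

theorem eventually_bind_map {V : Ultrafilter X} {W : X → Ultrafilter X} {p : X → Prop} :
    (∀ᶠ x in V.bind fun y => (W y).map (y + ·), p x) ↔ ∀ᶠ y in V, ∀ᶠ r in W y, p (y + r) :=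
  Iff.rfl

variable {V : Ultrafilter X} {U : List X → X → Prop} {c : ℝ}

theorem exists_isRemainder {F : List X}
    (hF : Acc (fun G F => ∃ y, GoodStep U c F y ∧ G = y :: F) F) :
    ∃ W, IsRemainder V U c F W := by
  induction hF with
  | intro F _ ih =>
    by_cases h : ∀ᶠ y in V, GoodStep U c F y
    · have : ∀ y, ∃ W, GoodStep U c F y → IsRemainder V U c (y :: F) W := fun y => by
        by_cases hy : GoodStep U c F y
        · obtain ⟨W, hW⟩ := ih (y :: F) ⟨y, hy, rfl⟩
          exact ⟨W, fun _ => hW⟩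
        · exact ⟨V, fun h => absurd h hy⟩
      choose W hW using this
      exact ⟨_, .node F W h hW⟩
    · exact ⟨_, .leaf F h⟩

theorem exists_seq_of_not_acc
    (h : ¬Acc (fun G F => ∃ y, GoodStep U c F y ∧ G = y :: F) []) :
    ∃ v : ℕ → X, ∀ n, GoodStep U c (hist v n) (v n) := by
  refine exists_seq_hist
    (fun F => ¬Acc (fun G F => ∃ y, GoodStep U c F y ∧ G = y :: F) F) _ h fun F hF => ?_
  by_contra hcon
  push Not at hcon
  refine hF (Acc.intro _ ?_)
  rintro _ ⟨y, hy, rfl⟩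
  exact hcon y hy

theorem IsRemainder.eventually_norm_le {F : List X} {W : Ultrafilter X}
    (h : IsRemainder V U c F W) (hF : ‖F.sum‖ ≤ c) : ∀ᶠ r : X in W, ‖F.sum + r‖ ≤ c := by
  induction h with
  | leaf F h => simpa using hF
  | node F W h hW ih =>
    rw [eventually_bind_map]
    filter_upwards [h] with y hy
    have hs : (y :: F).sum = F.sum + y := by rw [List.sum_cons, add_comm]
    have := ih y hy (hs ▸ hy.2.1)
    simpa only [hs, add_assoc] using this

theorem eventually_forall_append {α β : Type*} {l : Filter β} (G : List α)
    {p : List α → α → List α → β → Prop} (h : ∀ F x G', ∀ᶠ y in l, p F x G' y) :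
    ∀ᶠ y in l, ∀ F x G', G = F ++ x :: G' → p F x G' y := by
  induction G generalizing p with
  | nil => simp
  | cons a G ih =>
    filter_upwards [h [] a G, ih fun F x G' => h (a :: F) x G'] with y h1 h2 F x G' hG
    cases F with
    | nil =>
      obtain ⟨rfl, rfl⟩ := List.cons.inj hG
      exact h1
    | cons b F =>
      obtain ⟨rfl, hFG⟩ := List.cons.inj hG
      exact h2 F x G' hFG

theorem eventually_goodStep_nil (h1 : ∀ᶠ v : X in V, ‖v‖ = 1) (hU : ∀ F, ∀ᶠ x in V, U F x)
    (hc : 1 ≤ c) : ∀ᶠ x in V, GoodStep U c [] x := by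
  filter_upwards [h1, hU []] with x hx hUx
  refine ⟨hUx, ?_, ?_⟩ <;> simpa [hx] using hc

variable [NormedSpace ℝ X]

theorem IsRemainder.weaklyNull (hV : WeaklyNull V) {F : List X} {W : Ultrafilter X}
    (h : IsRemainder V U c F W) : WeaklyNull W := by
  induction h with
  | leaf F h =>
    refine weaklyNull_of_forall fun f ε hε => ?_
    simpa using hε
  | node F W h hW ih =>
    refine weaklyNull_of_forall fun f ε hε => eventually_bind_map.2 ?_
    filter_upwards [h, hV.eventually_lt f (half_pos hε)] with y hy hfy
    filter_upwards [(ih y hy).eventually_lt f (half_pos hε)] with r hr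
    rw [map_add]
    exact (abs_add_le _ _).trans_lt (by linarith)

/-- Typical vectors may be followed by a typical path of bound `c` and one more signed vector,
with sums below a bound `b > c`. -/
theorem IsRemainder.eventually_eventually_norm_lt (hV : WeaklyNull V)
    (h1 : ∀ᶠ v : X in V, ‖v‖ = 1) (hU : ∀ F, ∀ᶠ x in V, U F x) (hc : 1 ≤ c)
    (hA : ∀ W : Ultrafilter X, WeaklyNull W → NormLE W c → NormLE (conv W (reflect W)) c)
    {W : Ultrafilter X} (hW : IsRemainder V U c [] W) {b : ℝ} (hb : c < b) :
    ∀ᶠ x : X in V, ∀ᶠ r : X in W, ∀ᶠ y : X in V, ‖x + r + y‖ < b ∧ ‖x + r - y‖ < b := by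
  have hWn := hW.weaklyNull hV
  have hWc : NormLE W c := fun c' hc' => by
    filter_upwards [hW.eventually_norm_le (by simpa using by linarith)] with r hr
    rw [List.sum_nil, zero_add] at hr
    exact hr.trans_lt hc'
  obtain ⟨hp, hm⟩ := normLE_three hWn hWc hA
  obtain ⟨b₂, hcb₂, hb₂⟩ := exists_between hb
  obtain ⟨b₁, hcb₁, hb₁⟩ := exists_between hcb₂
  have hWV : ∃ T : X → Ultrafilter X, (∀ᶠ y in V, WeaklyNull (T y)) ∧
      W = V.bind fun y => (T y).map (y + ·) := by
    cases hW with
    | leaf _ h => exact absurd (eventually_goodStep_nil h1 hU hc) h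
    | node _ T h hT => exact ⟨T, h.mono fun y hy => (hT y hy).weaklyNull hV, rfl⟩
  obtain ⟨T, hT, hWT⟩ := hWV
  have hunfold : ∀ {p : X → Prop}, (∀ᶠ x in W, p x) ↔ ∀ᶠ y in V, ∀ᶠ r in T y, p (y + r) := by
    intro p
    rw [hWT, eventually_bind_map]
  have first : ∀ B : Ultrafilter X, NormLE (conv W B) c →
      ∀ᶠ x : X in V, ∀ᶠ p : X in B, ‖x + p‖ < b₂ := by
    intro B hB
    have := eventually_conv.1 (hB b₁ hcb₁)
    rw [hunfold] at this
    filter_upwards [this, hT] with x hx hTx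
    refine hTx.drop B (x + ·) hb₁ ?_
    filter_upwards [hx] with r hr
    filter_upwards [hr] with p hp
    rwa [add_left_comm, ← add_assoc]
  filter_upwards [first _ hp, first _ hm] with x hx hx'
  filter_upwards [eventually_conv.1 hx, eventually_conv.1 hx'] with r hr hr'
  rw [eventually_reflect] at hr'
  rw [hunfold] at hr hr'
  filter_upwards [hr, hr', hT] with y hy hy' hTy
  constructor
  · obtain ⟨-, h⟩ := (hTy.drop (pure ()) (fun _ => x + r + y) hb₂ (by
      filter_upwards [hy] with t ht
      refine Eventually.of_forall fun _ => ?_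
      rwa [show t + (x + r + y) = x + (r + (y + t)) by abel])).exists
    exact h
  · obtain ⟨-, h⟩ := (hTy.reflect.drop (pure ()) (fun _ => x + r - y) hb₂ (by
      rw [eventually_reflect]
      filter_upwards [hy'] with t ht
      refine Eventually.of_forall fun _ => ?_
      rwa [show -t + (x + r - y) = x + (r + -(y + t)) by abel])).exists
    exact h

/-- If reflected sums do not increase norms, there is a generic sequence with signed partial sums
bounded by `1 + δ`. -/
theorem exists_seq_goodStep (hV : WeaklyNull V) (h1 : ∀ᶠ v : X in V, ‖v‖ = 1)
    (hA : ∀ R : ℝ, 0 < R → ∀ W : Ultrafilter X, WeaklyNull W → NormLE W R →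
      NormLE (conv W (reflect W)) R)
    (hU : ∀ F, ∀ᶠ x in V, U F x) {δ : ℝ} (hδ : 0 < δ) :
    ∃ v : ℕ → X, ∀ n, GoodStep U (1 + δ) (hist v n) (v n) := by
  by_contra hcon
  let c : ℕ → ℝ := fun i => 1 + δ * (1 / 2) ^ i
  have hc1 : ∀ i, 1 ≤ c i := fun i => le_add_of_nonneg_right (by positivity)
  have hcle : ∀ i, c i ≤ 1 + δ := fun i => by
    have : (1 / 2 : ℝ) ^ i ≤ 1 := pow_le_one₀ (by norm_num) (by norm_num)
    have := mul_le_mul_of_nonneg_left this hδ.le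
    simp only [c]; linarith
  have hclt : ∀ i, c (i + 1) < c i := fun i => by
    have : 0 < δ * (1 / 2 : ℝ) ^ i := by positivity
    simp only [c, pow_succ]; linarith
  have hrem : ∀ i, ∃ W, IsRemainder V U (c i) [] W := fun i => by
    refine exists_isRemainder (by_contra fun h => hcon ?_)
    obtain ⟨v, hv⟩ := exists_seq_of_not_acc h
    exact ⟨v, fun n => ⟨(hv n).1, (hv n).2.1.trans (hcle i), (hv n).2.2.trans (hcle i)⟩⟩
  choose b hcb hbc using fun i => exists_between (hclt i)
  let J : ℕ → X → List X → Prop := fun i x F => ∃ W, IsRemainder V U (c (i + 1)) F W ∧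
    ∀ᶠ r in W, ∀ᶠ y in V, ‖x + F.sum + r + y‖ < b i ∧ ‖x + F.sum + r - y‖ < b i
  have hJnil : ∀ i, ∀ᶠ x in V, J i x [] := fun i => by
    obtain ⟨W, hW⟩ := hrem (i + 1)
    filter_upwards [IsRemainder.eventually_eventually_norm_lt hV h1 hU (hc1 _)
      (hA _ (zero_lt_one.trans_le (hc1 _))) hW (hcb i)] with x hx
    exact ⟨W, hW, by simpa only [List.sum_nil, add_zero] using hx⟩
  have hJcons : ∀ i x F, J i x F →
      ∀ᶠ y in V, GoodStep U (c (i + 1)) F y → J i x (y :: F) := by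
    rintro i x F ⟨W, hW, hr⟩
    cases hW with
    | leaf _ h =>
      filter_upwards [(V.em _).resolve_left h] with y hy hy'
      exact absurd hy' hy
    | node _ W h hW =>
      rw [eventually_bind_map] at hr
      filter_upwards [hr] with y hy hgood
      refine ⟨W y, hW y hgood, ?_⟩
      have : ∀ r, x + F.sum + (y + r) = x + (y :: F).sum + r := fun r => by
        rw [List.sum_cons]; abel
      simpa only [this] using hy
  have hJgood : ∀ i x F, J i x F → ∀ᶠ y in V, GoodStep U (c i) (F ++ [x]) y := by
    rintro i x F ⟨W, hW, hr⟩
    have hWn := hW.weaklyNull hV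
    have e1 := hWn.drop V (fun y => x + F.sum + y) (hbc i) (by
      filter_upwards [hr] with r hr
      filter_upwards [hr] with y hy
      rw [show r + (x + F.sum + y) = x + F.sum + r + y by abel]
      exact hy.1)
    have e2 := hWn.drop V (fun y => x + F.sum - y) (hbc i) (by
      filter_upwards [hr] with r hr
      filter_upwards [hr] with y hy
      rw [show r + (x + F.sum - y) = x + F.sum + r - y by abel]
      exact hy.2)
    filter_upwards [hU (F ++ [x]), e1, e2] with y hy h1 h2
    have hs : (F ++ [x]).sum = x + F.sum := by simp [add_comm]
    exact ⟨hy, hs ▸ h1.le, hs ▸ h2.le⟩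
  obtain ⟨v, hv⟩ := exists_seq_typical V
    (fun G y => J G.length y [] ∧ GoodStep U (c G.length) [] y ∧
      ∀ F x G', G = F ++ x :: G' → J G'.length x F →
        (GoodStep U (c (G'.length + 1)) F y → J G'.length x (y :: F)) ∧
          GoodStep U (c G'.length) (F ++ [x]) y)
    (fun G => (hJnil _).and ((eventually_goodStep_nil h1 hU (hc1 _)).and
      (eventually_forall_append G fun F x G' => by
        by_cases h : J G'.length x F
        · filter_upwards [hJcons _ _ _ h, hJgood _ _ _ h] with y h1 h2 _
          exact ⟨h1, h2⟩
        · exact Eventually.of_forall fun y hy => absurd hy h)))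
  have main : ∀ d i, J i (v i) (hist (fun j => v (i + 1 + j)) d) ∧
      GoodStep U (c i) (hist (fun j => v (i + j)) d) (v (i + d)) := by
    intro d
    induction d with
    | zero =>
      intro i
      have := hv i
      rw [length_hist] at this
      exact ⟨this.1, this.2.1⟩
    | succ d ih =>
      intro i
      have h := (hv (i + 1 + d)).2.2 _ _ _ (hist_add v i d)
      rw [length_hist] at h
      obtain ⟨hJ, hG⟩ := h (ih i).1
      refine ⟨hJ (ih (i + 1)).2, ?_⟩
      have hseg := hist_add (fun j => v (i + j)) 0 d
      rw [show 0 + 1 + d = d + 1 by ring] at hseg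
      rw [hseg, show i + (d + 1) = i + 1 + d by ring]
      simp only [hist, zero_add, add_zero, ← add_assoc]
      exact hG
  refine hcon ⟨v, fun n => ?_⟩
  have := (main n 0).2
  simp only [zero_add] at this
  simpa only [c, pow_zero, mul_one] using this

theorem exists_bsa_gt_one (hinf : ¬FiniteDimensional ℝ X) :
    ∃ d > 1, ∃ S : Set X, S.Infinite ∧ IsBSA X S 1 1 d := by
  by_contra hcon
  push Not at hcon
  have hno : ∀ d > 1, ¬∃ S : Set X, S.Infinite ∧ IsBSA X S 1 1 d :=
    fun d hd ⟨S, hS, hb⟩ => hcon d hd S hS hb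
  obtain ⟨V, hV, h1⟩ := exists_weaklyNull_sphere hinf
  refine hno (3 / 2) (by norm_num) (exists_bsa_of_partial_sums hV h1 fun U hU => ?_)
  obtain ⟨v, hv⟩ := exists_seq_goodStep hV h1
    (fun R hR W hW => normLE_conv_reflect hno hR hW) hU (δ := 1 / 10) (by norm_num)
  exact ⟨v, fun n => ⟨(hv n).1, (hv n).2.2.trans (by norm_num)⟩⟩

theorem bddAbove_bsa :
    BddAbove {d : ℝ | ∃ S : Set X, S.Infinite ∧ IsBSA X S 1 1 d} := by
  refine ⟨2, ?_⟩
  rintro d ⟨S, hS, hb, ha⟩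
  obtain ⟨x, hx, y, hy, hxy⟩ := hS.nontrivial
  obtain ⟨f, hf, hd, -⟩ := ha x hx y hy hxy
  have bound : ∀ z ∈ S, |f z| ≤ 1 := fun z hz =>
    (f.le_of_opNorm_le_of_le hf (hb z hz)).trans (by norm_num)
  have h1 := abs_le.1 (bound x hx)
  have h2 := abs_le.1 (bound y hy)
  linarith

end Tree

/-- For every infinite-dimensional Banach space X with separable dual,
K_a(X) > 1. -/
theorem stmt12 {X : Type*} [NormedAddCommGroup X] [NormedSpace ℝ X]
    [CompleteSpace X] (hinf : ¬FiniteDimensional ℝ X)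
    [TopologicalSpace.SeparableSpace (X →L[ℝ] ℝ)] :
    1 < Ka X := by
  obtain ⟨d, hd, h⟩ := exists_bsa_gt_one hinf
  exact hd.lt.trans_le (le_csSup bddAbove_bsa h)
end
end

section
/- Let X be an infinite-dimensional reflexive Banach space. Then K_a(X) = K(X). -/
open Set Filter

noncomputable section

open Topology

/-- A ternary Ramsey-type selection principle along a filter on `ℕ` finer than `atTop`. -/
theorem exists_infinite_forall_lt_of_eventually {U : Filter ℕ} [U.NeBot] (hU : U ≤ atTop)
    {Q : ℕ → ℕ → ℕ → Prop} (h : ∀ᶠ p in U, ∀ᶠ q in U, ∀ᶠ r in U, Q p q r) :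
    ∃ M : Set ℕ, M.Infinite ∧ ∀ p ∈ M, ∀ q ∈ M, ∀ r ∈ M, p < q → q < r → Q p q r := by
  let good : Finset ℕ → Prop := fun s =>
    (∀ p ∈ s, ∀ᶠ q in U, ∀ᶠ r in U, Q p q r) ∧
    (∀ p ∈ s, ∀ q ∈ s, p < q → ∀ᶠ r in U, Q p q r) ∧
    (∀ p ∈ s, ∀ q ∈ s, ∀ r ∈ s, p < q → q < r → Q p q r)
  have extend : ∀ s : {s : Finset ℕ // good s},
      ∃ n, (∀ p ∈ s.1, p < n) ∧ good (insert n s.1) := by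
    rintro ⟨s, h1, h2, h3⟩
    have e0 : ∀ᶠ n in U, ∀ p ∈ s, p < n :=
      (Filter.eventually_all_finset s).2 fun p _ => hU (eventually_gt_atTop p)
    have e1 : ∀ᶠ n in U, ∀ p ∈ s, ∀ᶠ r in U, Q p n r :=
      (Filter.eventually_all_finset s).2 h1
    have e2 : ∀ᶠ n in U, ∀ p ∈ s, ∀ q ∈ s, p < q → Q p q n :=
      (Filter.eventually_all_finset s).2 fun p hp =>
        (Filter.eventually_all_finset s).2 fun q hq => by
          by_cases hpq : p < q
          · exact (h2 p hp q hq hpq).mono fun _ hr _ => hr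
          · exact Eventually.of_forall fun _ hr => absurd hr hpq
    obtain ⟨n, hn, hn0, hn1, hn2⟩ := (h.and (e0.and (e1.and e2))).exists
    refine ⟨n, hn0, ?_, ?_, ?_⟩
    · intro p hp
      rcases Finset.mem_insert.1 hp with rfl | hp
      · exact hn
      · exact h1 p hp
    · intro p hp q hq hpq
      rcases Finset.mem_insert.1 hq with rfl | hq
      · exact hn1 p ((Finset.mem_insert.1 hp).resolve_left hpq.ne)
      · exact h2 p ((Finset.mem_insert.1 hp).resolve_left (hpq.trans (hn0 q hq)).ne) q hq hpq
    · intro p hp q hq r hr hpq hqr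
      rcases Finset.mem_insert.1 hr with rfl | hr
      · have hq' := (Finset.mem_insert.1 hq).resolve_left hqr.ne
        have hp' := (Finset.mem_insert.1 hp).resolve_left (hpq.trans hqr).ne
        exact hn2 p hp' q hq' hpq
      · have hrn := hn0 r hr
        have hq' := (Finset.mem_insert.1 hq).resolve_left (hqr.trans hrn).ne
        have hp' := (Finset.mem_insert.1 hp).resolve_left (hpq.trans (hqr.trans hrn)).ne
        exact h3 p hp' q hq' r hr hpq hqr
  choose n hn hgood using extend
  let s : ℕ → {s : Finset ℕ // good s} := fun i =>
    Nat.rec ⟨∅, by simp [good]⟩ (fun _ t => ⟨insert (n t) t.1, hgood t⟩) i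
  have hs : ∀ i, (s (i + 1)).1 = insert (n (s i)) (s i).1 := fun i => rfl
  have hmono : Monotone fun i => (s i).1 :=
    monotone_nat_of_le_succ fun i => by rw [hs]; exact Finset.subset_insert _ _
  have hmem : ∀ i j, i < j → n (s i) ∈ (s j).1 := fun i j hij =>
    hmono (Nat.succ_le_of_lt hij) (by simp [hs])
  have hφ : StrictMono fun i => n (s i) := fun i j hij => hn _ _ (hmem i j hij)
  refine ⟨Set.range fun i => n (s i), Set.infinite_range_of_injective hφ.injective, ?_⟩
  rintro _ ⟨i, rfl⟩ _ ⟨j, rfl⟩ _ ⟨k, rfl⟩ hpq hqr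
  have hij := hφ.lt_iff_lt.1 hpq
  have hjk := hφ.lt_iff_lt.1 hqr
  exact (s (k + 1)).2.2.2 _ (hmem i (k + 1) (by omega)) _ (hmem j (k + 1) (by omega)) _
    (hmem k (k + 1) (by omega)) hpq hqr

/-- Banach–Alaoglu along an ultrafilter. -/
theorem exists_tendsto_apply_of_norm_le {ι E : Type*} [NormedAddCommGroup E] [NormedSpace ℝ E]
    (U : Ultrafilter ι) {f : ι → E →L[ℝ] ℝ} {C : ℝ} (hf : ∀ i, ‖f i‖ ≤ C) :
    ∃ g : E →L[ℝ] ℝ, ∀ x, Tendsto (fun i => f i x) U (𝓝 (g x)) := by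
  let F : ι → WeakDual ℝ E := fun i => StrongDual.toWeakDual (f i)
  obtain ⟨g, -, hg⟩ := (WeakDual.isCompact_closedBall (𝕜 := ℝ) (E := E) 0 C).ultrafilter_le_nhds
    (U.map F) (by
      rw [Ultrafilter.coe_map, le_principal_iff]
      exact Filter.mem_map.2 (Eventually.of_forall fun i => by simpa [F] using hf i))
  refine ⟨WeakDual.toStrongDual g, fun x => ?_⟩
  exact (WeakDual.eval_continuous (𝕜 := ℝ) (E := E) x).continuousAt.tendsto.comp
    (show Tendsto F U (𝓝 g) from hg)

/-- In a reflexive space, bounded families converge weakly along ultrafilters. -/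
theorem exists_weak_limit_of_norm_le {ι X : Type*} [NormedAddCommGroup X] [NormedSpace ℝ X]
    (hrefl : Function.Surjective (NormedSpace.inclusionInDoubleDual ℝ X))
    (U : Ultrafilter ι) {x : ι → X} {C : ℝ} (hx : ∀ i, ‖x i‖ ≤ C) :
    ∃ a : X, ∀ f : X →L[ℝ] ℝ, Tendsto (fun i => f (x i)) U (𝓝 (f a)) := by
  obtain ⟨g, hg⟩ := exists_tendsto_apply_of_norm_le U
    (f := fun i => NormedSpace.inclusionInDoubleDual ℝ X (x i)) (C := C)
    fun i => (NormedSpace.double_dual_bound ℝ X (x i)).trans (hx i)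
  obtain ⟨a, rfl⟩ := hrefl g
  exact ⟨a, fun f => by simpa using hg f⟩

/-- Bounded functionals indexed by pairs `m < n` are almost null on the other terms of a suitable
subsequence of a weakly null sequence. -/
theorem eventually_abs_apply_lt {X : Type*} [NormedAddCommGroup X] [NormedSpace ℝ X]
    (U : Ultrafilter ℕ) {y : ℕ → X} (hy : ∀ f : X →L[ℝ] ℝ, Tendsto (fun k => f (y k)) U (𝓝 0))
    {f : ℕ → ℕ → X →L[ℝ] ℝ} (hf : ∀ m n, ‖f m n‖ ≤ 1) {ε : ℝ} (hε : 0 < ε) :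
    ∀ᶠ p in U, ∀ᶠ q in U, ∀ᶠ r in U,
      |f q r (y p)| < ε ∧ |f p r (y q)| < ε ∧ |f p q (y r)| < ε := by
  have small : ∀ {a : ℕ → ℝ} {b : ℝ}, Tendsto a U (𝓝 b) → |b| < ε → ∀ᶠ k in U, |a k| < ε :=
    fun h hb => h.abs.eventually_lt_const hb
  have null : ∀ g : X →L[ℝ] ℝ, ∀ᶠ k in U, |g (y k)| < ε :=
    fun g => small (hy g) (by simpa using hε)
  choose g hg using fun m => exists_tendsto_apply_of_norm_le U (hf m)
  have hg1 : ∀ m, ‖g m‖ ≤ 1 := fun m =>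
    ContinuousLinearMap.opNorm_le_bound _ zero_le_one fun x =>
      le_of_tendsto (hg m x).norm (Eventually.of_forall fun n => (f m n).le_of_opNorm_le (hf m n) x)
  obtain ⟨g', hg'⟩ := exists_tendsto_apply_of_norm_le U hg1
  filter_upwards [null g'] with p hp
  filter_upwards [small (hg' (y p)) hp, null (g p)] with q hq hpq
  filter_upwards [small (hg q (y p)) hq, small (hg p (y q)) hpq, null (f p q)] with r h1 h2 h3
  exact ⟨h1, h2, h3⟩

/-- Functionals of norm at most one separating `y m` and `y n` antipodally, with room `δ`, from the
remaining terms of a subsequence. -/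
theorem exists_infinite_forall_exists_antipodal {X : Type*} [NormedAddCommGroup X]
    [NormedSpace ℝ X] {U : Ultrafilter ℕ} (hU : (U : Filter ℕ) ≤ atTop) {y : ℕ → X} {C d d' : ℝ}
    (hy : ∀ f : X →L[ℝ] ℝ, Tendsto (fun k => f (y k)) U (𝓝 0)) (hC : ∀ k, ‖y k‖ ≤ C)
    (hd : 0 < d) (hd' : d' < d) (hsep : ∀ m n, m ≠ n → d ≤ ‖y n - y m‖) :
    ∃ M : Set ℕ, M.Infinite ∧ ∀ m ∈ M, ∀ n ∈ M, m < n → ∃ f : X →L[ℝ] ℝ, ‖f‖ ≤ 1 ∧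
      d' ≤ f (y n) - f (y m) ∧ ∀ k ∈ M, f (y m) ≤ f (y k) ∧ f (y k) ≤ f (y n) := by
  choose h hh1 hh using fun n => exists_dual_vector'' ℝ (y n)
  choose f hf1 hf using fun m n => exists_dual_vector'' ℝ (y n - y m)
  simp only [RCLike.ofReal_real_eq_id, id, map_sub] at hh hf
  obtain ⟨L, -, hL⟩ := (isCompact_Icc (a := (0 : ℝ)) (b := C)).ultrafilter_le_nhds
    (U.map fun k => ‖y k‖) (by
      rw [Ultrafilter.coe_map, le_principal_iff]
      exact Filter.mem_map.2 (Eventually.of_forall fun k => ⟨norm_nonneg _, hC k⟩))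
  have hL : Tendsto (fun k => ‖y k‖) U (𝓝 L) := hL
  obtain ⟨ε, hε, h1, h2, h3⟩ : ∃ ε > 0, 4 * ε ≤ d ∧ 2 * ε ≤ d - d' ∧ (L < d → 2 * ε ≤ d - L) := by
    by_cases hLd : L < d
    · refine ⟨min (d / 4) (min ((d - d') / 2) ((d - L) / 2)), ?_, ?_, ?_, fun _ => ?_⟩
      · refine lt_min ?_ (lt_min ?_ ?_) <;> linarith
      · linarith [min_le_left (d / 4) (min ((d - d') / 2) ((d - L) / 2))]
      · linarith [min_le_right (d / 4) (min ((d - d') / 2) ((d - L) / 2)),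
          min_le_left ((d - d') / 2) ((d - L) / 2)]
      · linarith [min_le_right (d / 4) (min ((d - d') / 2) ((d - L) / 2)),
          min_le_right ((d - d') / 2) ((d - L) / 2)]
    · refine ⟨min (d / 4) ((d - d') / 2), ?_, ?_, ?_, fun h => absurd h hLd⟩
      · refine lt_min ?_ ?_ <;> linarith
      · linarith [min_le_left (d / 4) ((d - d') / 2)]
      · linarith [min_le_right (d / 4) ((d - d') / 2)]
  have hnorm : ∀ᶠ p in (U : Filter ℕ), |‖y p‖ - L| < ε := by
    have := hL.sub_const L
    rw [sub_self] at this
    exact this.abs.eventually_lt_const (by simpa using hε)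
  obtain ⟨M, hM, hQ⟩ := exists_infinite_forall_lt_of_eventually hU
    (((eventually_abs_apply_lt U hy hf1 hε).and
      (eventually_abs_apply_lt U hy (f := fun m _ => h m) (fun m _ => hh1 m) hε)).and hnorm |>.mono
      fun p hp => hp.1.1.and hp.1.2 |>.mono fun q hq => (hq.1.and hq.2).mono fun r hr =>
        (⟨hr, hp.2⟩ : _ ∧ _))
  have hnext : ∀ p ∈ M, ∀ q ∈ M, p < q →
      (|h q (y p)| < ε ∧ |h p (y q)| < ε) ∧ |‖y p‖ - L| < ε := fun p hp q hq hpq => by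
    obtain ⟨r, hr, hqr⟩ := hM.exists_gt q
    obtain ⟨⟨-, h1, h2, -⟩, h3⟩ := hQ p hp q hq r hr hpq hqr
    exact ⟨⟨h1, h2⟩, h3⟩
  have hyL : ∀ p ∈ M, |‖y p‖ - L| < ε := fun p hp => by
    obtain ⟨q, hq, hpq⟩ := hM.exists_gt p
    exact (hnext p hp q hq hpq).2
  have hhε : ∀ p ∈ M, ∀ q ∈ M, p ≠ q → |h p (y q)| < ε := fun p hp q hq hpq => by
    rcases hpq.lt_or_gt with hlt | hlt
    · exact (hnext p hp q hq hlt).1.2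
    · exact (hnext q hq p hp hlt).1.1
  have hfε : ∀ m ∈ M, ∀ n ∈ M, m < n → ∀ k ∈ M, k ≠ m → k ≠ n → |f m n (y k)| < ε :=
    fun m hm n hn hmn k hk hkm hkn => by
      rcases hkm.lt_or_gt with hlt | hlt
      · exact (hQ k hk m hm n hn hlt hmn).1.1.1
      · rcases hkn.lt_or_gt with hlt' | hlt'
        · exact (hQ m hm k hk n hn hlt hlt').1.1.2.1
        · exact (hQ m hm n hn k hk hmn hlt').1.1.2.2
  refine ⟨M, hM, fun m hm n hn hmn => ?_⟩
  suffices H : ∃ g : X →L[ℝ] ℝ, ‖g‖ ≤ 1 ∧ d' ≤ g (y n) - g (y m) ∧ ε ≤ g (y n) ∧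
      g (y m) ≤ -ε ∧ ∀ k ∈ M, k ≠ m → k ≠ n → |g (y k)| < ε by
    obtain ⟨g, hg1, hgd, hgn, hgm, hgk⟩ := H
    refine ⟨g, hg1, hgd, fun k hk => ?_⟩
    by_cases hkm : k = m
    · subst hkm
      constructor <;> linarith
    by_cases hkn : k = n
    · subst hkn
      constructor <;> linarith
    have := abs_lt.1 (hgk k hk hkm hkn)
    constructor <;> linarith
  have hLm := abs_lt.1 (hyL m hm)
  have hLn := abs_lt.1 (hyL n hn)
  by_cases hLd : L < d
  · have hδ := h3 hLd
    have hdiff := hf m n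
    have hs := hsep m n hmn.ne
    have hbound : ∀ k, |f m n (y k)| ≤ ‖y k‖ := fun k => by
      simpa using (f m n).le_of_opNorm_le (hf1 m n) (y k)
    have hbm := abs_le.1 (hbound m)
    have hbn := abs_le.1 (hbound n)
    exact ⟨f m n, hf1 m n, by linarith, by linarith, by linarith, hfε m hm n hn hmn⟩
  · have hmn' := abs_lt.1 (hhε m hm n hn hmn.ne)
    have hnm' := abs_lt.1 (hhε n hn m hm hmn.ne')
    have hm' := hh m
    have hn' := hh n
    have happ : ∀ x, ((1 / 2 : ℝ) • (h n - h m)) x = (h n x - h m x) / 2 := fun x => by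
      simp only [smul_apply, sub_apply, smul_eq_mul]
      ring
    refine ⟨(1 / 2 : ℝ) • (h n - h m), ?_, ?_, ?_, ?_, fun k hk hkm hkn => ?_⟩
    · rw [norm_smul, Real.norm_of_nonneg (by norm_num)]
      linarith [norm_sub_le (h n) (h m), hh1 n, hh1 m]
    · rw [happ, happ]
      linarith
    · rw [happ]
      linarith
    · rw [happ]
      linarith
    · rw [happ, abs_lt]
      have := abs_lt.1 (hhε m hm k hk hkm.symm)
      have := abs_lt.1 (hhε n hn k hk hkn.symm)
      constructor <;> linarith

/-- In a reflexive space a `d`-separated infinite subset of the unit ball yields, for each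
`d' < d`, a `(1, 1, d')`-bounded and separated antipodal infinite subset. -/
theorem exists_infinite_isBSA_of_separated {X : Type*} [NormedAddCommGroup X] [NormedSpace ℝ X]
    (hrefl : Function.Surjective (NormedSpace.inclusionInDoubleDual ℝ X)) {S : Set X} {d d' : ℝ}
    (hS1 : S ⊆ Metric.closedBall 0 1) (hS : S.Infinite) (hd : 0 < d) (hd' : d' < d)
    (hsep : ∀ x ∈ S, ∀ y ∈ S, x ≠ y → d ≤ ‖x - y‖) :
    ∃ T : Set X, T.Infinite ∧ IsBSA X T 1 1 d' := by
  let x : ℕ → X := fun n => hS.natEmbedding S n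
  have hxinj : Function.Injective x :=
    Subtype.val_injective.comp (hS.natEmbedding S).injective
  have hxS : ∀ n, x n ∈ S := fun n => (hS.natEmbedding S n).2
  have hx1 : ∀ n, ‖x n‖ ≤ 1 := fun n => by simpa using hS1 (hxS n)
  have hU : ((hyperfilter ℕ : Ultrafilter ℕ) : Filter ℕ) ≤ atTop := by
    rw [← Nat.cofinite_eq_atTop]
    exact hyperfilter_le_cofinite
  obtain ⟨a, ha⟩ := exists_weak_limit_of_norm_le hrefl (hyperfilter ℕ) hx1
  obtain ⟨M, hM, hMf⟩ := exists_infinite_forall_exists_antipodal hU (y := fun n => x n - a)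
    (C := 1 + ‖a‖) (d := d) (d' := d')
    (fun f => by simpa using (ha f).sub_const (f a))
    (fun k => (norm_sub_le _ _).trans (by linarith [hx1 k])) hd hd'
    (fun m n hmn => by
      rw [sub_sub_sub_cancel_right]
      exact hsep _ (hxS n) _ (hxS m) (hxinj.ne hmn.symm))
  refine ⟨x '' M, hM.image hxinj.injOn, ?_, ?_⟩
  · rintro _ ⟨n, -, rfl⟩
    exact hx1 n
  · rintro _ ⟨m, hm, rfl⟩ _ ⟨n, hn, rfl⟩ hmn
    have hmn : m ≠ n := fun h => hmn (h ▸ rfl)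
    rcases hmn.lt_or_gt with hlt | hlt
    · obtain ⟨f, hf1, hfd, hfk⟩ := hMf m hm n hn hlt
      simp only [map_sub] at hfd hfk
      refine ⟨f, hf1, by linarith, ?_⟩
      rintro _ ⟨k, hk, rfl⟩
      have := hfk k hk
      constructor <;> linarith
    · obtain ⟨f, hf1, hfd, hfk⟩ := hMf n hn m hm hlt
      simp only [map_sub] at hfd hfk
      refine ⟨-f, by rwa [norm_neg], by simp only [neg_apply]; linarith, ?_⟩
      rintro _ ⟨k, hk, rfl⟩
      have := hfk k hk
      simp only [neg_apply]
      constructor <;> linarith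

/-- For every infinite-dimensional reflexive Banach space X, K_a(X) = K(X). -/
theorem stmt14 {X : Type*} [NormedAddCommGroup X] [NormedSpace ℝ X]
    [CompleteSpace X] (hinf : ¬FiniteDimensional ℝ X)
    (hrefl : Function.Surjective (NormedSpace.inclusionInDoubleDual ℝ X)) :
    Ka X = Kc X := by
  have hsub : {d : ℝ | ∃ S : Set X, S.Infinite ∧ IsBSA X S 1 1 d} ⊆
      {d : ℝ | ∃ S : Set X, S ⊆ Metric.closedBall 0 1 ∧ S.Infinite ∧
        ∀ x ∈ S, ∀ y ∈ S, x ≠ y → d ≤ ‖x - y‖} := by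
    rintro d ⟨S, hS, hS1, hSd⟩
    refine ⟨S, fun x hx => by simpa using hS1 x hx, hS, fun x hx y hy hxy => ?_⟩
    obtain ⟨f, hf1, hfd, -⟩ := hSd x hx y hy hxy
    calc d ≤ f (y - x) := by rwa [map_sub]
      _ ≤ ‖f (y - x)‖ := Real.le_norm_self _
      _ ≤ 1 * ‖y - x‖ := f.le_of_opNorm_le hf1 _
      _ = ‖x - y‖ := by rw [one_mul, norm_sub_rev]
  have hbdd : BddAbove {d : ℝ | ∃ S : Set X, S ⊆ Metric.closedBall 0 1 ∧ S.Infinite ∧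
      ∀ x ∈ S, ∀ y ∈ S, x ≠ y → d ≤ ‖x - y‖} := by
    refine ⟨2, ?_⟩
    rintro d ⟨S, hS1, hS, hSd⟩
    obtain ⟨x, hx, y, hy, hxy⟩ := hS.nontrivial
    have hx1 : ‖x‖ ≤ 1 := by simpa using hS1 hx
    have hy1 : ‖y‖ ≤ 1 := by simpa using hS1 hy
    linarith [hSd x hx y hy hxy, norm_sub_le x y]
  have hzero : (0 : ℝ) ∈ {d : ℝ | ∃ S : Set X, S.Infinite ∧ IsBSA X S 1 1 d} := by
    have : Nontrivial X := by
      by_contra h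
      rw [not_nontrivial_iff_subsingleton] at h
      exact hinf inferInstance
    have : (𝓝[≠] (0 : X)).NeBot := Module.punctured_nhds_neBot ℝ X 0
    refine ⟨Metric.closedBall 0 1,
      infinite_of_mem_nhds 0 (Metric.closedBall_mem_nhds 0 one_pos),
      fun x hx => by simpa using hx, fun x _ y _ _ => ⟨0, by simp, by simp, by simp⟩⟩
  refine le_antisymm (csSup_le_csSup hbdd ⟨0, hzero⟩ hsub) (csSup_le ⟨0, hsub hzero⟩ ?_)
  rintro d ⟨S, hS1, hS, hSd⟩
  rcases le_or_gt d 0 with hd | hd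
  · exact hd.trans (le_csSup (hbdd.mono hsub) hzero)
  · exact le_of_forall_lt_imp_le_of_dense fun d' hd' => le_csSup (hbdd.mono hsub)
      (exists_infinite_isBSA_of_separated hrefl hS1 hS hd hd' hSd)
end
end
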